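/- arXiv:1311.1579 — 7 statements merged into one kernel-verified Lean document; each statement's English description precedes it below -/
import Mathlib

section
/- For every integer n ≥ 6, the polynomial system f1 = 0, f2 = 0, f3 = 0 has at least four pairwise distinct solutions (x2, x12, x13) consisting of positive real numbers: two solutions with x13 = 1 and two solutions with x13 ≠ 1. -/
/-- `f1` from the Einstein equations for the Stiefel manifold `V₄ℝⁿ = SO(n)/SO(n-4)`
(with the normalization `x23 = 1`). -/
def f1 (n x2 x12 x13 : ℝ) : ℝ :=
  -(n - 4) * x12 ^ 3 * x2 + (n - 4) * x12 ^ 2 * x13 * x2 ^ 2 + (n - 4) * x12 * x13 ^ 2 * x2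
    - 2 * (n - 2) * x12 * x13 * x2 + (n - 4) * x12 * x2 + x12 ^ 2 * x13 + 3 * x13 * x2 ^ 2

/-- `f2` from the Einstein equations for `V₄ℝⁿ`. -/
def f2 (n x2 x12 x13 : ℝ) : ℝ :=
  (n - 3) * x12 ^ 3 - 2 * (n - 2) * x12 ^ 2 * x13 - (n - 5) * x12 * x13 ^ 2
    + 2 * (n - 2) * x12 * x13 + (3 - n) * x12 + 2 * x12 ^ 2 * x13 * x2 - 2 * x13 * x2

/-- `f3` from the Einstein equations for `V₄ℝⁿ`. -/
def f3 (n x2 x12 x13 : ℝ) : ℝ :=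
  (n - 2) * x12 * x13 - (n - 2) * x12 + x12 ^ 2 - x12 * x13 * x2 - 2 * x13 ^ 2 + 2

/-- The equation left after eliminating `x2` from `f2 = f3 = 0`, as a quadratic in `c = x13`
with coefficients depending on `a = x12`. -/
def elimQuad (n a c : ℝ) : ℝ :=
  (4 - (n - 1) * a ^ 2) * c ^ 2 + 2 * ((n - 2) * a * (a - 1)) * c
    + (a ^ 2 - 1) * ((n - 1) * a ^ 2 - 2 * (n - 2) * a + 4)

/-- `f3 = 0` says that `x2 * x12 * x13` equals this polynomial in `a = x12`, `c = x13`. -/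
def elimNum (n a c : ℝ) : ℝ :=
  a ^ 2 + (c - 1) * ((n - 2) * a - 2 * (c + 1))

/-- `x12 ^ 2 * x13 * f1` after eliminating `x2` by means of `f3 = 0`. -/
def elimF1 (n a c : ℝ) : ℝ :=
  ((n - 4) * a ^ 2 + 3) * elimNum n a c ^ 2 + a ^ 4 * c ^ 2
    + a ^ 2 * elimNum n a c * ((n - 4) * ((1 - c) ^ 2 - a ^ 2) - 4 * c)

/-- The quotient of `elimF1` by `c - 1`, as a function of `e = c - 1`. -/
def elimF1Quot (n a e : ℝ) : ℝ :=
  (2 * a ^ 2 * ((n - 2) * a - 4 - 2 * e) + e * ((n - 2) * a - 4 - 2 * e) ^ 2)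
      * ((n - 4) * a ^ 2 + 3)
    + a ^ 4 * ((n - 3) * e - 2)
    + a ^ 2 * ((n - 2) * a - 4 - 2 * e) * ((n - 4) * (e ^ 2 - a ^ 2) - 4 - 4 * e)

lemma elimF1_eq_mul (n a c : ℝ) : elimF1 n a c = (c - 1) * elimF1Quot n a (c - 1) := by
  unfold elimF1 elimF1Quot elimNum; ring

lemma elimF1_pos_of_elimNum_nonpos {n a c : ℝ} (hn : 4 ≤ n) (ha : 0 < a) (hc : 0 < c)
    (hac : (1 - c) ^ 2 ≤ a ^ 2) (h : elimNum n a c ≤ 0) : 0 < elimF1 n a c := by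
  have h1 : 0 ≤ elimNum n a c * ((n - 4) * ((1 - c) ^ 2 - a ^ 2) - 4 * c) :=
    mul_nonneg_of_nonpos_of_nonpos h (by nlinarith)
  have h2 : 0 ≤ (n - 4) * a ^ 2 + 3 := by nlinarith [sq_nonneg a]
  unfold elimF1
  nlinarith [mul_nonneg h2 (sq_nonneg (elimNum n a c)), mul_nonneg (sq_nonneg a) h1,
    (by positivity : 0 < a ^ 4 * c ^ 2)]

lemma exists_solution_of_elim {n a c : ℝ} (hn : 4 ≤ n) (ha : 0 < a) (hc : 0 < c)
    (hac : (1 - c) ^ 2 ≤ a ^ 2) (hq : elimQuad n a c = 0) (hF : elimF1 n a c = 0) :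
    ∃ b, 0 < b ∧ f1 n b a c = 0 ∧ f2 n b a c = 0 ∧ f3 n b a c = 0 := by
  have hN : 0 < elimNum n a c := by
    by_contra! h
    exact (elimF1_pos_of_elimNum_nonpos hn ha hc hac h).ne' hF
  obtain ⟨b, hb⟩ : ∃ b, b = elimNum n a c / (a * c) := ⟨_, rfl⟩
  have hb0 : 0 < b := by rw [hb]; positivity
  have hbN : elimNum n a c = b * (a * c) := by rw [hb]; field_simp
  refine ⟨b, hb0, ?_, ?_, ?_⟩
  · have : a ^ 2 * c * f1 n b a c = 0 := by
      rw [← hF]; unfold elimF1; rw [hbN]; unfold f1; ring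
    exact (mul_eq_zero.mp this).resolve_left (by positivity)
  · have : a * f2 n b a c = 0 := by
      have h : a * f2 n b a c
          = elimQuad n a c + 2 * (a ^ 2 - 1) * (b * (a * c) - elimNum n a c) := by
        unfold f2 elimQuad elimNum; ring
      rw [h, hq, hbN]; ring
    exact (mul_eq_zero.mp this).resolve_left ha.ne'
  · have h : f3 n b a c = elimNum n a c - b * (a * c) := by
      unfold f3 elimNum; ring
    rw [h, hbN]; ring

/-- Intermediate value theorem along the branch of larger roots of a quadratic whose coefficients
depend continuously on a parameter. -/
lemma exists_zero_on_larger_root {α β γ : ℝ → ℝ} {Φ : ℝ → ℝ → ℝ} {x₀ x₁ : ℝ} (hx : x₀ ≤ x₁)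
    (hα : Continuous α) (hβ : Continuous β) (hγ : Continuous γ)
    (hΦ : Continuous fun p : ℝ × ℝ => Φ p.1 p.2)
    (hpos : ∀ x ∈ Set.Icc x₀ x₁, 0 < α x)
    (hdisc : ∀ x ∈ Set.Icc x₀ x₁, 0 ≤ β x ^ 2 - α x * γ x)
    (h₀ : ∀ c, α x₀ * c ^ 2 - 2 * β x₀ * c + γ x₀ = 0 → β x₀ ≤ α x₀ * c → Φ x₀ c ≤ 0)
    (h₁ : ∀ c, α x₁ * c ^ 2 - 2 * β x₁ * c + γ x₁ = 0 → β x₁ ≤ α x₁ * c → 0 ≤ Φ x₁ c) :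
    ∃ x ∈ Set.Icc x₀ x₁, ∃ c, α x * c ^ 2 - 2 * β x * c + γ x = 0 ∧ β x ≤ α x * c ∧
      Φ x c = 0 := by
  let r : ℝ → ℝ := fun x => (β x + √(β x ^ 2 - α x * γ x)) / α x
  have hr : ∀ x ∈ Set.Icc x₀ x₁,
      α x * r x ^ 2 - 2 * β x * r x + γ x = 0 ∧ β x ≤ α x * r x := by
    intro x hx
    have h1 := hpos x hx
    have h2 := Real.sq_sqrt (hdisc x hx)
    have h3 : α x * r x = β x + √(β x ^ 2 - α x * γ x) := by
      simp only [r]; field_simp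
    have h4 := Real.sqrt_nonneg (β x ^ 2 - α x * γ x)
    refine ⟨?_, by linarith⟩
    have h5 : α x * (α x * r x ^ 2 - 2 * β x * r x + γ x) = 0 := by
      have : α x * (α x * r x ^ 2 - 2 * β x * r x + γ x)
          = (α x * r x - β x) ^ 2 - (β x ^ 2 - α x * γ x) := by ring
      rw [this, h3, add_sub_cancel_left, h2, sub_self]
    exact (mul_eq_zero.mp h5).resolve_left h1.ne'
  have hrc : ContinuousOn r (Set.Icc x₀ x₁) :=
    ContinuousOn.div (by fun_prop) hα.continuousOn fun x hx => (hpos x hx).ne'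
  have hcont : ContinuousOn (fun x => Φ x (r x)) (Set.Icc x₀ x₁) :=
    hΦ.comp_continuousOn (continuousOn_id.prodMk hrc)
  have hl := hr x₀ (Set.left_mem_Icc.mpr hx)
  have hu := hr x₁ (Set.right_mem_Icc.mpr hx)
  obtain ⟨x, hx, hx0⟩ :=
    intermediate_value_Icc hx hcont ⟨h₀ _ hl.1 hl.2, h₁ _ hu.1 hu.2⟩
  exact ⟨x, hx, r x, (hr x hx).1, (hr x hx).2, hx0⟩

lemma lt_larger_root {α β γ c y : ℝ} (hα : 0 < α) (hc : α * c ^ 2 - 2 * β * c + γ = 0)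
    (hβ : β ≤ α * c) (hy : α * y ^ 2 - 2 * β * y + γ < 0) : y < c := by
  by_contra! h
  nlinarith [mul_nonneg (sub_nonneg.mpr h) (sub_nonneg.mpr hβ),
    mul_nonneg hα.le (sq_nonneg (y - c))]

lemma larger_root_lt {α β γ c y : ℝ} (hα : 0 < α) (hc : α * c ^ 2 - 2 * β * c + γ = 0)
    (hβy : β ≤ α * y) (hy : 0 < α * y ^ 2 - 2 * β * y + γ) : c < y := by
  by_contra! h
  nlinarith [mul_nonneg (sub_nonneg.mpr h) (sub_nonneg.mpr hβy),
    mul_nonneg hα.le (sq_nonneg (y - c))]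

lemma larger_root_le {α β γ c y z : ℝ} (hα : 0 < α) (hc : α * c ^ 2 - 2 * β * c + γ = 0)
    (hzy : z ≤ y) (hz : α * z ^ 2 - 2 * β * z + γ < 0)
    (hy : 0 ≤ α * y ^ 2 - 2 * β * y + γ) : c ≤ y := by
  by_contra! h
  nlinarith [mul_nonneg hα.le (mul_nonneg (mul_nonneg (sub_nonneg.mpr (hzy.trans h.le))
      (sub_nonneg.mpr hzy)) (sub_nonneg.mpr h.le)),
    mul_pos (sub_pos.mpr h) (neg_pos.mpr hz), mul_nonneg (sub_nonneg.mpr (hzy.trans h.le)) hy,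
    congrArg (fun x => (y - z) * x) hc]

lemma discr_nonneg_of_neg {α β γ y : ℝ} (hα : 0 < α)
    (hy : α * y ^ 2 - 2 * β * y + γ < 0) : 0 ≤ β ^ 2 - α * γ := by
  nlinarith [sq_nonneg (α * y - β), mul_pos hα (neg_pos.mpr hy)]

lemma continuous_elimF1 (n : ℝ) : Continuous fun p : ℝ × ℝ => elimF1 n p.1 p.2 := by
  unfold elimF1 elimNum; fun_prop

lemma elimQuad_at_one (n a : ℝ) :
    elimQuad n a 1 = a ^ 2 * ((n - 1) * a ^ 2 - 2 * (n - 2) * a + 2) := by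
  unfold elimQuad; ring

section Endpoints

variable {n e a : ℝ}

lemma elimF1Quot_nonpos (hn : 6 ≤ n) (he : 0 ≤ e) (he' : e < 1 / (2 * (n - 1) ^ 2)) :
    elimF1Quot n (3 / (2 * n - 3)) e ≤ 0 := by
  have key : ∀ {k t u : ℝ}, 0 ≤ k → 0 ≤ t → 0 < u →
      0 ≤ -elimF1Quot (6 + k) (3 / (9 + 2 * k)) (t / ((t + u) * (2 * (5 + k) ^ 2))) := by
    intro k t u hk ht hu
    unfold elimF1Quot
    field_simp
    ring_nf
    positivity
  have hd : 0 < 2 * (n - 1) ^ 2 := by nlinarith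
  have h := key (sub_nonneg.mpr hn) (mul_nonneg he hd.le)
    (sub_pos.mpr ((lt_div_iff₀ hd).mp he'))
  rw [show 9 + 2 * (n - 6) = 2 * n - 3 by ring, show 5 + (n - 6) = n - 1 by ring,
    add_sub_cancel, add_sub_cancel, one_mul, mul_div_cancel_right₀ _ hd.ne'] at h
  linarith

lemma elimF1Quot_nonneg (hn : 6 ≤ n) (he : 0 ≤ e) (he' : e < 7 / (4 * (n - 1))) :
    0 ≤ elimF1Quot n (2 - 15 / (4 * (n - 1))) (-e) := by
  have key : ∀ {k t u : ℝ}, 0 ≤ k → 0 ≤ t → 0 < u →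
      0 ≤ elimF1Quot (6 + k) (2 - 15 / (4 * (5 + k)))
        (-(7 * t / ((t + u) * (4 * (5 + k))))) := by
    intro k t u hk ht hu
    unfold elimF1Quot
    field_simp
    ring_nf
    positivity
  have hd : 0 < 4 * (n - 1) := by linarith
  have h := key (sub_nonneg.mpr hn) (mul_nonneg he hd.le)
    (sub_pos.mpr ((lt_div_iff₀ hd).mp he'))
  rwa [show 5 + (n - 6) = n - 1 by ring, add_sub_cancel, add_sub_cancel,
    mul_div_mul_left _ _ (by norm_num), mul_div_cancel_right₀ _ hd.ne'] at h

lemma elimQuad_pos_near_one (hn : 6 ≤ n) :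
    0 < elimQuad n (3 / (2 * n - 3)) (1 + 1 / (2 * (n - 1) ^ 2)) := by
  obtain ⟨k, hk, rfl⟩ : ∃ k, 0 ≤ k ∧ n = 6 + k := ⟨n - 6, by linarith, by ring⟩
  rw [show 2 * (6 + k) - 3 = 9 + 2 * k by ring, show 6 + k - 1 = 5 + k by ring]
  unfold elimQuad
  field_simp
  ring_nf
  positivity

lemma elimQuad_pos_below_one (hn : 6 ≤ n) :
    0 < elimQuad n (2 - 15 / (4 * (n - 1))) (1 - 7 / (4 * (n - 1))) := by
  obtain ⟨k, hk, rfl⟩ : ∃ k, 0 ≤ k ∧ n = 6 + k := ⟨n - 6, by linarith, by ring⟩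
  rw [show 6 + k - 1 = 5 + k by ring]
  unfold elimQuad
  field_simp
  ring_nf
  positivity

lemma elimQuad_neg_of_seven_le (hn : 7 ≤ n) :
    elimQuad n (2 - 6 / n) (1 - 7 / (2 * n)) < 0 := by
  obtain ⟨k, hk, rfl⟩ : ∃ k, 0 ≤ k ∧ n = 7 + k := ⟨n - 7, by linarith, by ring⟩
  rw [← neg_pos]
  unfold elimQuad
  field_simp
  ring_nf
  positivity

lemma elimNum_neg_of_seven_le (hn : 7 ≤ n) :
    elimNum n (2 - 6 / n) (1 - 7 / (2 * n)) < 0 := by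
  obtain ⟨k, hk, rfl⟩ : ∃ k, 0 ≤ k ∧ n = 7 + k := ⟨n - 7, by linarith, by ring⟩
  rw [← neg_pos]
  unfold elimNum
  field_simp
  ring_nf
  positivity

lemma discr_factor_nonneg_of_seven_le (hn : 7 ≤ n) (ha : 2 - 6 / n ≤ a) :
    0 ≤ (a - 1) * (n - 2) ^ 2 * a ^ 2
      + (a + 1) * ((n - 1) * a ^ 2 - 4) * ((n - 1) * a ^ 2 - 2 * (n - 2) * a + 4) := by
  obtain ⟨k, hk, rfl⟩ : ∃ k, 0 ≤ k ∧ n = 7 + k := ⟨n - 7, by linarith, by ring⟩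
  obtain ⟨s, hs, rfl⟩ : ∃ s, 0 ≤ s ∧ a = 2 - 6 / (7 + k) + s :=
    ⟨a - (2 - 6 / (7 + k)), by linarith, by ring⟩
  rw [show 7 + k - 1 = 6 + k by ring, show 7 + k - 2 = 5 + k by ring]
  field_simp
  ring_nf
  positivity

end Endpoints

lemma exists_elim_zero_one_lt {n : ℝ} (hn : 6 ≤ n) :
    ∃ a c, 0 < a ∧ 1 < c ∧ (1 - c) ^ 2 ≤ a ^ 2 ∧ elimQuad n a c = 0 ∧ elimF1 n a c = 0 := by
  have hd : 0 < 2 * n - 3 := by linarith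
  have hm : 0 < n - 1 := by linarith
  have hle : 3 / (2 * n - 3) ≤ 4 / (n - 1) := by
    rw [div_le_div_iff₀ hd hm]; nlinarith
  have hrange : ∀ x ∈ Set.Icc (3 / (2 * n - 3)) (4 / (n - 1)),
      0 < x ∧ (n - 1) * x ≤ 4 ∧ 0 < 4 - (n - 1) * x ^ 2 ∧
        (n - 1) * x ^ 2 - 2 * (n - 2) * x + 2 < 0 := by
    rintro x ⟨h1, h2⟩
    have hx : 0 < x := lt_of_lt_of_le (by positivity) h1
    rw [div_le_iff₀ hd] at h1
    rw [le_div_iff₀ hm] at h2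
    refine ⟨hx, by linarith, ?_, ?_⟩
    · nlinarith
    · nlinarith
  have hquad : ∀ x c, (4 - (n - 1) * x ^ 2) * c ^ 2 - 2 * ((n - 2) * x * (1 - x)) * c
      + (x ^ 2 - 1) * ((n - 1) * x ^ 2 - 2 * (n - 2) * x + 4) = elimQuad n x c := by
    intro x c; unfold elimQuad; ring
  have hone : ∀ x ∈ Set.Icc (3 / (2 * n - 3)) (4 / (n - 1)), elimQuad n x 1 < 0 := by
    intro x hx
    obtain ⟨h1, -, -, h4⟩ := hrange x hx
    rw [elimQuad_at_one]
    exact mul_neg_of_pos_of_neg (by positivity) h4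
  have hbound : ∀ x ∈ Set.Icc (3 / (2 * n - 3)) (4 / (n - 1)), ∀ c, elimQuad n x c = 0 →
      (n - 2) * x * (1 - x) ≤ (4 - (n - 1) * x ^ 2) * c → 1 < c ∧ c ≤ 1 + x := by
    intro x hx c hc hβ
    obtain ⟨h1, h2, h3, -⟩ := hrange x hx
    rw [← hquad] at hc
    have h1x := hone x hx
    rw [← hquad] at h1x
    refine ⟨lt_larger_root h3 hc hβ h1x, larger_root_le h3 hc (by linarith) h1x ?_⟩
    rw [hquad, show elimQuad n x (1 + x) = 2 * x * (1 + x) * (4 - (n - 1) * x) by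
      unfold elimQuad; ring]
    have : 0 ≤ 4 - (n - 1) * x := by linarith
    positivity
  obtain ⟨a, ha, c, hc, hβ, hF⟩ := exists_zero_on_larger_root
    (α := fun x => 4 - (n - 1) * x ^ 2) (β := fun x => (n - 2) * x * (1 - x))
    (γ := fun x => (x ^ 2 - 1) * ((n - 1) * x ^ 2 - 2 * (n - 2) * x + 4)) hle
    (by fun_prop) (by fun_prop) (by fun_prop) (continuous_elimF1 n)
    (fun x hx => (hrange x hx).2.2.1)
    (fun x hx => discr_nonneg_of_neg (y := 1) (hrange x hx).2.2.1
      (by rw [hquad]; exact hone x hx))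
    (fun c hc hβ => by
      rw [hquad] at hc
      have hx := Set.left_mem_Icc.mpr hle
      obtain ⟨h1, -⟩ := hbound _ hx c hc hβ
      have h2 : c < 1 + 1 / (2 * (n - 1) ^ 2) := by
        by_contra! h
        have h3 := hone _ hx
        have h4 := elimQuad_pos_near_one hn
        rw [← hquad] at h3 h4 hc
        have h5 := larger_root_le (hrange _ hx).2.2.1 hc
          (by linarith [show (0 : ℝ) < 1 / (2 * (n - 1) ^ 2) by positivity]) h3 h4.le
        rw [le_antisymm h5 h] at hc
        linarith
      rw [elimF1_eq_mul]
      exact mul_nonpos_of_nonneg_of_nonpos (by linarith)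
        (elimF1Quot_nonpos hn (by linarith) (by linarith)))
    (fun c hc hβ => by
      rw [hquad] at hc
      have hx := Set.right_mem_Icc.mpr hle
      obtain ⟨hx0, -, h3, -⟩ := hrange _ hx
      obtain ⟨h1, h2⟩ := hbound _ hx c hc hβ
      have h4 : elimQuad n (4 / (n - 1)) (1 + 4 / (n - 1)) = 0 := by
        unfold elimQuad; field_simp; ring
      have h5 : c = 1 + 4 / (n - 1) := by
        by_contra h
        have h6 : c < 1 + 4 / (n - 1) := lt_of_le_of_ne h2 h
        have h7 := hone _ hx
        rw [← hquad] at hc h4 h7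
        nlinarith [mul_pos h3 (mul_pos (sub_pos.mpr h1) (sub_pos.mpr h6))]
      refine (elimF1_pos_of_elimNum_nonpos (by linarith) hx0 (by linarith) ?_ ?_).le
      · rw [h5]; apply le_of_eq; ring
      · rw [h5, show elimNum n (4 / (n - 1)) (1 + 4 / (n - 1)) = -(2 * (4 / (n - 1)) ^ 2) by
          unfold elimNum; field_simp; ring]
        exact neg_nonpos.mpr (by positivity))
  rw [hquad] at hc
  obtain ⟨h1, h2⟩ := hbound a ha c hc hβ
  exact ⟨a, c, (hrange a ha).1, h1, by nlinarith, hc, hF⟩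

lemma exists_elim_zero_lt_one {n x₀ y : ℝ} (hn : 6 ≤ n) (hx₀ : 1 < x₀)
    (hle : x₀ ≤ 2 - 15 / (4 * (n - 1)))
    (hone₀ : (n - 1) * x₀ ^ 2 - 2 * (n - 2) * x₀ + 2 < 0)
    (hdisc : ∀ x ∈ Set.Icc x₀ (2 - 15 / (4 * (n - 1))),
      0 ≤ (x - 1) * (n - 2) ^ 2 * x ^ 2
        + (x + 1) * ((n - 1) * x ^ 2 - 4) * ((n - 1) * x ^ 2 - 2 * (n - 2) * x + 4))
    (hy : elimQuad n x₀ y < 0) (hβy : (n - 2) * x₀ * (x₀ - 1) ≤ ((n - 1) * x₀ ^ 2 - 4) * y)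
    (hy1 : y ≤ 1) (hNy : elimNum n x₀ y ≤ 0) :
    ∃ a c, 0 < a ∧ 0 < c ∧ c < 1 ∧ (1 - c) ^ 2 ≤ a ^ 2 ∧ elimQuad n a c = 0 ∧
      elimF1 n a c = 0 := by
  have hm : 0 < n - 1 := by linarith
  set x₁ := 2 - 15 / (4 * (n - 1)) with hx₁
  have hx₁' : (n - 1) * x₁ = 2 * (n - 1) - 15 / 4 := by rw [hx₁]; field_simp
  have hone₁ : (n - 1) * x₁ ^ 2 - 2 * (n - 2) * x₁ + 2 < 0 := by
    have h : 5 / 4 ≤ x₁ := by nlinarith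
    linarith [congrArg (fun z => x₁ * z) hx₁']
  have hα : ∀ x, x₀ ≤ x → 0 < (n - 1) * x ^ 2 - 4 := by
    intro x hx; nlinarith
  have hquad : ∀ x c, ((n - 1) * x ^ 2 - 4) * c ^ 2 - 2 * ((n - 2) * x * (x - 1)) * c
      + (1 - x ^ 2) * ((n - 1) * x ^ 2 - 2 * (n - 2) * x + 4) = -elimQuad n x c := by
    intro x c; unfold elimQuad; ring
  have hone : ∀ x ∈ Set.Icc x₀ x₁, elimQuad n x 1 < 0 := by
    rintro x ⟨h1, h2⟩
    rw [elimQuad_at_one]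
    refine mul_neg_of_pos_of_neg (by nlinarith) ?_
    by_contra! h
    have h3 : 0 < (n - 1) * (x + x₀) - 2 * (n - 2) :=
      pos_of_mul_pos_right (a := x - x₀) (by linarith) (by linarith)
    have h4 : 0 < 2 * (n - 2) - (n - 1) * (x + x₁) :=
      pos_of_mul_pos_right (a := x₁ - x) (by linarith) (by linarith)
    nlinarith
  have hbound : ∀ x ∈ Set.Icc x₀ x₁, ∀ c, elimQuad n x c = 0 →
      (n - 2) * x * (x - 1) ≤ ((n - 1) * x ^ 2 - 4) * c → 0 < c ∧ c < 1 := by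
    rintro x ⟨h1, h2⟩ c hc hβ
    have h3 := hα x h1
    constructor
    · have : 0 < (n - 2) * x * (x - 1) :=
        mul_pos (mul_pos (by linarith) (by linarith)) (by linarith)
      exact pos_of_mul_pos_right (this.trans_le hβ) h3.le
    · refine larger_root_lt h3 (by rw [hquad, hc, neg_zero]) (by nlinarith)
        (by rw [hquad]; exact neg_pos.mpr (hone x ⟨h1, h2⟩))
  obtain ⟨a, ha, c, hc, hβ, hF⟩ := exists_zero_on_larger_root
    (α := fun x => (n - 1) * x ^ 2 - 4) (β := fun x => (n - 2) * x * (x - 1))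
    (γ := fun x => (1 - x ^ 2) * ((n - 1) * x ^ 2 - 2 * (n - 2) * x + 4))
    (Φ := fun x c => -elimF1 n x c) hle
    (by fun_prop) (by fun_prop) (by fun_prop) (continuous_elimF1 n).neg
    (fun x hx => hα x hx.1)
    (fun x hx => by
      have h := mul_nonneg (sub_nonneg.mpr (hx₀.le.trans hx.1)) (hdisc x hx)
      linarith)
    (fun c hc hβ => by
      have hc' : c < y := larger_root_lt (hα x₀ le_rfl) hc hβy
        (by rw [hquad]; exact neg_pos.mpr hy)
      rw [hquad, neg_eq_zero] at hc
      obtain ⟨h1, h2⟩ := hbound _ (Set.left_mem_Icc.mpr hle) c hc hβ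
      refine neg_nonpos.mpr (elimF1_pos_of_elimNum_nonpos (by linarith) (by linarith) h1
        (by nlinarith) (le_trans ?_ hNy)).le
      unfold elimNum
      nlinarith [mul_nonneg (sub_nonneg.mpr hc'.le)
        (show 0 ≤ (n - 2) * x₀ - 2 * (y + c) by nlinarith)])
    (fun c hc hβ => by
      have h3 : 1 - 7 / (4 * (n - 1)) < c := lt_larger_root (hα x₁ hle) hc hβ
        (by rw [hquad]; exact neg_neg_iff_pos.mpr (elimQuad_pos_below_one hn))
      rw [hquad, neg_eq_zero] at hc
      obtain ⟨h1, h2⟩ := hbound _ (Set.right_mem_Icc.mpr hle) c hc hβ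
      have h4 := elimF1Quot_nonneg (e := 1 - c) hn (by linarith) (by linarith)
      rw [neg_sub] at h4
      rw [elimF1_eq_mul, ← neg_mul, neg_sub]
      exact mul_nonneg (by linarith) h4)
  rw [hquad, neg_eq_zero] at hc
  obtain ⟨h1, h2⟩ := hbound a ha c hc hβ
  have ha0 : 1 < a := hx₀.trans_le ha.1
  exact ⟨a, c, by linarith, h1, h2, by nlinarith, hc, neg_eq_zero.mp hF⟩

lemma exists_elim_zero_lt_one_six :
    ∃ a c, 0 < a ∧ 0 < c ∧ c < 1 ∧ (1 - c) ^ 2 ≤ a ^ 2 ∧ elimQuad 6 a c = 0 ∧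
      elimF1 6 a c = 0 := by
  refine exists_elim_zero_lt_one (x₀ := 1.02) (y := 0.28) (by norm_num) (by norm_num)
    (by norm_num) (by norm_num) ?_ (by norm_num [elimQuad]) (by norm_num) (by norm_num)
    (by norm_num [elimNum])
  rintro x ⟨h, -⟩
  have h1 : 0 ≤ x - 1 := by linarith
  have h2 : 0 ≤ (6 - 1) * x ^ 2 - 4 := by nlinarith
  have h3 : 0 ≤ (6 - 1) * x ^ 2 - 2 * (6 - 2) * x + 4 := by nlinarith [sq_nonneg (x - 0.8)]
  have h4 : 0 ≤ x + 1 := by linarith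
  positivity

lemma exists_elim_zero_lt_one_of_seven_le {n : ℝ} (hn : 7 ≤ n) :
    ∃ a c, 0 < a ∧ 0 < c ∧ c < 1 ∧ (1 - c) ^ 2 ≤ a ^ 2 ∧ elimQuad n a c = 0 ∧
      elimF1 n a c = 0 := by
  refine exists_elim_zero_lt_one (x₀ := 2 - 6 / n) (y := 1 - 7 / (2 * n)) (by linarith)
    ?_ ?_ ?_ (fun x hx => discr_factor_nonneg_of_seven_le hn hx.1)
    (elimQuad_neg_of_seven_le hn) ?_ ?_ (elimNum_neg_of_seven_le hn).le
  all_goals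
    obtain ⟨k, hk, rfl⟩ : ∃ k, 0 ≤ k ∧ n = 7 + k := ⟨n - 7, by linarith, by ring⟩
    try simp only [show 7 + k - 1 = 6 + k by ring, show 7 + k - 2 = 5 + k by ring]
    first | rw [← sub_pos] | rw [← sub_nonneg]
    field_simp
    ring_nf
    positivity

lemma exists_solutions_one {n : ℝ} (hn : 6 ≤ n) :
    ∃ a a' : ℝ, a < a' ∧ ∀ x ∈ ({a, a'} : Set ℝ),
      0 < x ∧ f1 n x x 1 = 0 ∧ f2 n x x 1 = 0 ∧ f3 n x x 1 = 0 := by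
  have hs : 0 < n ^ 2 - 6 * n + 6 := by nlinarith
  have hsq := Real.sq_sqrt hs.le
  have hs0 := Real.sqrt_pos.mpr hs
  set s := √(n ^ 2 - 6 * n + 6)
  have hsn : s < n - 2 := by nlinarith
  have hm : 0 < n - 1 := by linarith
  have key : ∀ x, 0 < x → ((n - 1) * x - (n - 2)) ^ 2 = s ^ 2 →
      0 < x ∧ f1 n x x 1 = 0 ∧ f2 n x x 1 = 0 ∧ f3 n x x 1 = 0 := by
    intro x hx h
    have h1 : (n - 1) * ((n - 1) * x ^ 2 - 2 * (n - 2) * x + 2) = 0 := by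
      rw [hsq] at h; linarith
    have h2 := (mul_eq_zero.mp h1).resolve_left hm.ne'
    refine ⟨hx, by unfold f1; ring, ?_, by unfold f3; ring⟩
    have : f2 n x x 1 = x * ((n - 1) * x ^ 2 - 2 * (n - 2) * x + 2) := by unfold f2; ring
    rw [this, h2, mul_zero]
  refine ⟨(n - 2 - s) / (n - 1), (n - 2 + s) / (n - 1), by gcongr; linarith, ?_⟩
  rintro x (rfl | rfl)
  · exact key _ (div_pos (by linarith) hm) (by field_simp; ring)
  · exact key _ (div_pos (by linarith) hm) (by field_simp; ring)

/-- For every integer `n ≥ 6`, the system `f1 = f2 = f3 = 0` has at least four pairwise distinct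
positive solutions `(x2, x12, x13)`: two with `x13 = 1` and two with `x13 ≠ 1`. -/
theorem stmt0 (n : ℕ) (hn : 6 ≤ n) :
    ∃ s₁ s₂ s₃ s₄ : ℝ × ℝ × ℝ,
      (s₁ ≠ s₂ ∧ s₁ ≠ s₃ ∧ s₁ ≠ s₄ ∧ s₂ ≠ s₃ ∧ s₂ ≠ s₄ ∧ s₃ ≠ s₄) ∧
      (∀ s ∈ [s₁, s₂, s₃, s₄],
        0 < s.1 ∧ 0 < s.2.1 ∧ 0 < s.2.2 ∧
        f1 n s.1 s.2.1 s.2.2 = 0 ∧ f2 n s.1 s.2.1 s.2.2 = 0 ∧ f3 n s.1 s.2.1 s.2.2 = 0) ∧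
      s₁.2.2 = 1 ∧ s₂.2.2 = 1 ∧ s₃.2.2 ≠ 1 ∧ s₄.2.2 ≠ 1 := by
  have hn' : (6 : ℝ) ≤ n := by exact_mod_cast hn
  obtain ⟨a₁, a₂, hlt, h₁₂⟩ := exists_solutions_one hn'
  obtain ⟨p₁, e₁⟩ := h₁₂ a₁ (by simp)
  obtain ⟨p₂, e₂⟩ := h₁₂ a₂ (by simp)
  obtain ⟨a₃, c₃, ha₃, hc₃, hac₃, hq₃, hF₃⟩ := exists_elim_zero_one_lt hn'
  have h₄ : ∃ a c, 0 < a ∧ 0 < c ∧ c < 1 ∧ (1 - c) ^ 2 ≤ a ^ 2 ∧ elimQuad n a c = 0 ∧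
      elimF1 n a c = 0 := by
    rcases hn.eq_or_lt with rfl | h
    · exact_mod_cast exists_elim_zero_lt_one_six
    · exact exists_elim_zero_lt_one_of_seven_le (by exact_mod_cast h)
  obtain ⟨a₄, c₄, ha₄, hc₄, hc₄', hac₄, hq₄, hF₄⟩ := h₄
  obtain ⟨b₃, hb₃, e₃⟩ :=
    exists_solution_of_elim (by linarith) ha₃ (by linarith) hac₃ hq₃ hF₃
  obtain ⟨b₄, hb₄, e₄⟩ := exists_solution_of_elim (by linarith) ha₄ hc₄ hac₄ hq₄ hF₄
  refine ⟨(a₁, a₁, 1), (a₂, a₂, 1), (b₃, a₃, c₃), (b₄, a₄, c₄), ?_, ?_, rfl, rfl,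
    hc₃.ne', hc₄'.ne⟩
  · simp only [ne_eq, Prod.mk.injEq, not_and]
    refine ⟨fun h => absurd h hlt.ne, fun _ _ h => hc₃.ne h, fun _ _ h => hc₄'.ne' h,
      fun _ _ h => hc₃.ne h, fun _ _ h => hc₄'.ne' h, fun _ _ h => ?_⟩
    linarith
  · simp only [List.forall_mem_cons, List.not_mem_nil, IsEmpty.forall_iff, implies_true,
      and_true]
    exact ⟨⟨p₁, p₁, one_pos, e₁⟩, ⟨p₂, p₂, one_pos, e₂⟩, ⟨hb₃, ha₃, by linarith, e₃⟩,
      hb₄, ha₄, hc₄, e₄⟩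
end

section
/- For every integer n ≥ 6 one has n² − 6n + 6 > 0, both numbers t₋ = (n−2−√(n²−6n+6))/(n−1) and t₊ = (n−2+√(n²−6n+6))/(n−1) are positive, and for t = t₋ and for t = t₊ the triple (x2, x12, x13) = (t, t, 1) satisfies f1 = 0, f2 = 0 and f3 = 0 (these are the Jensen solutions). -/
/-- On the line `(t, t, 1)` the system reduces to `(n - 1) t² - 2 (n - 2) t + 2 = 0`. -/
theorem jensen_of_quadratic {n t : ℝ} (h : (n - 1) * t ^ 2 - 2 * (n - 2) * t + 2 = 0) :
    f1 n t t 1 = 0 ∧ f2 n t t 1 = 0 ∧ f3 n t t 1 = 0 := by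
  refine ⟨by unfold f1; ring, ?_, by unfold f3; ring⟩
  unfold f2
  linear_combination t * h

/-- The quadratic formula for `(n - 1) t² - 2 (n - 2) t + 2`, with `s` a square root of its
reduced discriminant. -/
theorem quadratic_of_sq_eq {n s : ℝ} (hn : n - 1 ≠ 0) (hs : s ^ 2 = n ^ 2 - 6 * n + 6) :
    (n - 1) * ((n - 2 + s) / (n - 1)) ^ 2 - 2 * (n - 2) * ((n - 2 + s) / (n - 1)) + 2 = 0 := by
  field_simp
  linear_combination hs

/-- For every integer `n ≥ 6`: `n² - 6n + 6 > 0`, the two Jensen values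
`t = (n - 2 ∓ √(n² - 6n + 6))/(n - 1)` are positive, and `(x2, x12, x13) = (t, t, 1)`
solves the system `f1 = f2 = f3 = 0`. -/
theorem stmt1 (n : ℕ) (hn : 6 ≤ n) :
    (0 : ℝ) < (n : ℝ) ^ 2 - 6 * n + 6 ∧
    ∀ t ∈ ({((n : ℝ) - 2 - Real.sqrt ((n : ℝ) ^ 2 - 6 * n + 6)) / ((n : ℝ) - 1),
            ((n : ℝ) - 2 + Real.sqrt ((n : ℝ) ^ 2 - 6 * n + 6)) / ((n : ℝ) - 1)} : Set ℝ),
      0 < t ∧ f1 n t t 1 = 0 ∧ f2 n t t 1 = 0 ∧ f3 n t t 1 = 0 := by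
  have hn' : (6 : ℝ) ≤ n := by exact_mod_cast hn
  have hd : (0 : ℝ) < (n : ℝ) ^ 2 - 6 * n + 6 := by nlinarith
  have hlt : √((n : ℝ) ^ 2 - 6 * n + 6) < n - 2 := by
    rw [Real.sqrt_lt' (by linarith)]
    nlinarith
  have hs := Real.sq_sqrt hd.le
  have hs0 := Real.sqrt_nonneg ((n : ℝ) ^ 2 - 6 * n + 6)
  have hn1 : (0 : ℝ) < n - 1 := by linarith
  refine ⟨hd, ?_⟩
  rintro t (rfl | rfl)
  · refine ⟨div_pos (by linarith) hn1, jensen_of_quadratic ?_⟩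
    rw [sub_eq_add_neg _ √_]
    exact quadratic_of_sq_eq hn1.ne' (by rw [neg_sq, hs])
  · exact ⟨div_pos (by linarith) hn1, jensen_of_quadratic (quadratic_of_sq_eq hn1.ne' hs)⟩
end

section
/- For every integer n ≥ 6 there exist positive real numbers x2, x12 and a real number x13 with 0 < x13 < 1 such that f1 = 0, f2 = 0 and f3 = 0. -/
/-- A root beyond `s` of a concave quadratic that is positive at `s` lies below any point to the right of
`s` at which the quadratic is negative. -/
lemma root_lt_of_quadratic_neg {A B C s b u : ℝ} (hA : A < 0) (hs : 0 < A * s ^ 2 + B * s + C)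
    (hsb : s < b) (hsu : s < u) (hb : A * b ^ 2 + B * b + C = 0)
    (hu : A * u ^ 2 + B * u + C < 0) : b < u := by
  by_contra! h
  have key : (b - s) * (A * u ^ 2 + B * u + C) = (b - u) * (A * s ^ 2 + B * s + C)
      + (u - s) * (A * b ^ 2 + B * b + C) - A * ((b - u) * (u - s) * (b - s)) := by ring
  rw [hb] at key
  have h1 : (b - s) * (A * u ^ 2 + B * u + C) < 0 := mul_neg_of_pos_of_neg (by linarith) hu
  have h2 : 0 ≤ (b - u) * (A * s ^ 2 + B * s + C) := mul_nonneg (by linarith) hs.le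
  have h3 : 0 ≤ (b - u) * (u - s) * (b - s) :=
    mul_nonneg (mul_nonneg (by linarith) (by linarith)) (by linarith)
  nlinarith

/-- A root to the right of `s` of a concave quadratic that is positive at `s` lies above any point
at which the quadratic is positive. -/
lemma lt_root_of_quadratic_pos {A B C s b l : ℝ} (hA : A < 0) (hs : 0 < A * s ^ 2 + B * s + C)
    (hsb : s < b) (hb : A * b ^ 2 + B * b + C = 0)
    (hl : 0 < A * l ^ 2 + B * l + C) : l < b := by
  by_contra! h
  have key : (l - s) * (A * b ^ 2 + B * b + C) = (l - b) * (A * s ^ 2 + B * s + C)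
      + (b - s) * (A * l ^ 2 + B * l + C) - A * ((l - b) * (b - s) * (l - s)) := by ring
  rw [hb] at key
  have h1 : 0 < (b - s) * (A * l ^ 2 + B * l + C) := mul_pos (by linarith) hl
  have h2 : 0 ≤ (l - b) * (A * s ^ 2 + B * s + C) := mul_nonneg (by linarith) hs.le
  have h3 : 0 ≤ (l - b) * (b - s) * (l - s) :=
    mul_nonneg (mul_nonneg (by linarith) (by linarith)) (by linarith)
  nlinarith

/-- The larger root of a concave quadratic that is positive at `s` and negative at `1`, where `1`
is beyond the vertex. -/
lemma larger_root_spec {A B C s : ℝ} (hA : A < 0) (hs : 0 < A * s ^ 2 + B * s + C)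
    (h1 : A + B + C < 0) (hv : 2 * A + B < 0) :
    s < (-B - √(B ^ 2 - 4 * A * C)) / (2 * A) ∧ (-B - √(B ^ 2 - 4 * A * C)) / (2 * A) < 1 ∧
      A * ((-B - √(B ^ 2 - 4 * A * C)) / (2 * A)) ^ 2
        + B * ((-B - √(B ^ 2 - 4 * A * C)) / (2 * A)) + C = 0 := by
  have hD : (2 * A * s + B) ^ 2 < B ^ 2 - 4 * A * C := by nlinarith
  have hD0 : 0 ≤ B ^ 2 - 4 * A * C := (sq_nonneg _).trans hD.le
  have hlow : |2 * A * s + B| < √(B ^ 2 - 4 * A * C) := Real.lt_sqrt_of_sq_lt (by rwa [sq_abs])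
  have hup : √(B ^ 2 - 4 * A * C) < -(2 * A + B) := by
    rw [Real.sqrt_lt' (by linarith)]
    nlinarith
  have hsq := Real.sq_sqrt hD0
  generalize √(B ^ 2 - 4 * A * C) = d at *
  have hlow' := neg_abs_le (2 * A * s + B)
  refine ⟨?_, ?_, ?_⟩
  · rw [lt_div_iff_of_neg (by linarith)]
    linarith
  · rw [div_lt_iff_of_neg (by linarith)]
    linarith
  · have hA0 : A ≠ 0 := hA.ne
    field_simp
    linear_combination hsq

/-- The polynomial in `x12 = a`, `x13 = b` obtained by eliminating `x2` from `f2` with `f3`. -/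
def eliminant (n a b : ℝ) : ℝ :=
  (4 - (n - 1) * a ^ 2) * b ^ 2 + 2 * (n - 2) * a * (a - 1) * b
    + (a ^ 2 - 1) * ((n - 1) * a ^ 2 - 2 * (n - 2) * a + 4)

/-- The value of `x2` which solves `f3 = 0` is `numer n a b / (a * b)`. -/
def numer (n a b : ℝ) : ℝ := (n - 2) * a * (b - 1) + a ^ 2 - 2 * b ^ 2 + 2

lemma f3_eq_zero {n a b : ℝ} (ha : a ≠ 0) (hb : b ≠ 0) : f3 n (numer n a b / (a * b)) a b = 0 := by
  unfold f3 numer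
  field_simp
  ring

lemma f2_eq_zero {n a b : ℝ} (ha : a ≠ 0) (hb : b ≠ 0) (h : eliminant n a b = 0) :
    f2 n (numer n a b / (a * b)) a b = 0 := by
  have : f2 n (numer n a b / (a * b)) a b = eliminant n a b / a := by
    unfold f2 numer eliminant
    field_simp
    ring
  rw [this, h, zero_div]

/-- An intermediate value argument along the branch of `eliminant n a b = 0` with `s < b < 1`. -/
lemma exists_solution {n lo hi s : ℝ} (hn : 6 ≤ n) (hlo : 1 < lo) (hlohi : lo ≤ hi) (hs : 0 ≤ s)
    (hpos : ∀ a ∈ Set.Icc lo hi, 0 < eliminant n a s) (hneg : ∀ a ∈ Set.Icc lo hi, eliminant n a 1 < 0)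
    (hleft : ∀ b, s < b → b < 1 → eliminant n lo b = 0 → numer n lo b ≤ 0)
    (hright : ∀ b, s < b → b < 1 → eliminant n hi b = 0 →
      f1 n (max (numer n hi b / (hi * b)) 0) hi b < 0) :
    ∃ x2 x12 x13 : ℝ, 0 < x2 ∧ 0 < x12 ∧ 0 < x13 ∧ x13 < 1 ∧
      f1 n x2 x12 x13 = 0 ∧ f2 n x2 x12 x13 = 0 ∧ f3 n x2 x12 x13 = 0 := by
  let A : ℝ → ℝ := fun a => 4 - (n - 1) * a ^ 2
  let B : ℝ → ℝ := fun a => 2 * (n - 2) * a * (a - 1)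
  let C : ℝ → ℝ := fun a => (a ^ 2 - 1) * ((n - 1) * a ^ 2 - 2 * (n - 2) * a + 4)
  let r : ℝ → ℝ := fun a => (-B a - √(B a ^ 2 - 4 * A a * C a)) / (2 * A a)
  have hA : ∀ a ∈ Set.Icc lo hi, A a < 0 := fun a ha => by
    have : 1 < a := hlo.trans_le ha.1
    simp only [A]
    nlinarith
  have hr : ∀ a ∈ Set.Icc lo hi, s < r a ∧ r a < 1 ∧ eliminant n a (r a) = 0 := fun a ha => by
    have h1 : 1 < a := hlo.trans_le ha.1
    refine larger_root_spec (hA a ha) (hpos a ha) ?_ ?_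
    · have := hneg a ha
      simp only [eliminant] at this
      simp only [A, B, C]
      linarith
    · simp only [A, B]
      nlinarith
  let c : ℝ → ℝ := fun a => numer n a (r a) / (a * r a)
  have hab : ∀ a ∈ Set.Icc lo hi, 0 < a ∧ 0 < r a := fun a ha =>
    ⟨by linarith [ha.1], hs.trans_lt (hr a ha).1⟩
  have hrcont : ContinuousOn r (Set.Icc lo hi) := by
    refine ContinuousOn.div (by fun_prop) (by fun_prop) fun a ha => ?_
    exact mul_ne_zero two_ne_zero (hA a ha).ne
  have hccont : ContinuousOn c (Set.Icc lo hi) := by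
    refine ContinuousOn.div (by unfold numer; fun_prop) (by fun_prop) fun a ha => ?_
    exact (mul_pos (hab a ha).1 (hab a ha).2).ne'
  have hFcont : ContinuousOn (fun a => f1 n (max (c a) 0) a (r a)) (Set.Icc lo hi) := by
    have : ContinuousOn (fun a => max (c a) 0) (Set.Icc lo hi) := hccont.sup continuousOn_const
    unfold f1
    fun_prop
  have hnonpos : ∀ a ∈ Set.Icc lo hi, c a ≤ 0 → 0 < f1 n (max (c a) 0) a (r a) := by
    intro a ha h
    rw [max_eq_right h]
    have := mul_pos (pow_pos (hab a ha).1 2) (hab a ha).2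
    unfold f1
    linarith
  have hl : lo ∈ Set.Icc lo hi := Set.left_mem_Icc.2 hlohi
  have hh : hi ∈ Set.Icc lo hi := Set.right_mem_Icc.2 hlohi
  have hcl : c lo ≤ 0 := div_nonpos_of_nonpos_of_nonneg
    (hleft _ (hr lo hl).1 (hr lo hl).2.1 (hr lo hl).2.2)
    (mul_pos (hab lo hl).1 (hab lo hl).2).le
  obtain ⟨a, ha, hFa⟩ := intermediate_value_Icc' hlohi hFcont
    ⟨(hright _ (hr hi hh).1 (hr hi hh).2.1 (hr hi hh).2.2).le, (hnonpos lo hl hcl).le⟩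
  have hca : 0 < c a := by
    by_contra! h
    exact (hnonpos a ha h).ne' hFa
  obtain ⟨ha0, hb0⟩ := hab a ha
  refine ⟨c a, a, r a, hca, ha0, hb0, (hr a ha).2.1, ?_, f2_eq_zero ha0.ne' hb0.ne' (hr a ha).2.2,
    f3_eq_zero ha0.ne' hb0.ne'⟩
  simpa only [max_eq_left hca.le] using hFa

lemma exists_solution_six : ∃ x2 x12 x13 : ℝ, 0 < x2 ∧ 0 < x12 ∧ 0 < x13 ∧ x13 < 1 ∧
    f1 6 x2 x12 x13 = 0 ∧ f2 6 x2 x12 x13 = 0 ∧ f3 6 x2 x12 x13 = 0 := by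
  refine exists_solution (lo := 101 / 100) (hi := 9 / 8) (s := 0) le_rfl (by norm_num)
    (by norm_num) le_rfl ?_ ?_ ?_ ?_
  · rintro a ⟨h1, h2⟩
    have : 0 < (a ^ 2 - 1) * ((6 - 1) * a ^ 2 - 2 * (6 - 2) * a + 4) :=
      mul_pos (by nlinarith) (by nlinarith [sq_nonneg (5 * a - 4)])
    unfold eliminant
    linarith
  · rintro a ⟨h1, h2⟩
    have : eliminant 6 a 1 = a ^ 2 * (5 * a ^ 2 - 8 * a + 2) := by unfold eliminant; ring
    rw [this]
    exact mul_neg_of_pos_of_neg (by positivity) (by nlinarith)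
  · intro b h0 h1 hb
    have : b < 1 / 4 := by
      refine root_lt_of_quadratic_neg ?_ ?_ h0 (by norm_num) hb ?_ <;> norm_num
    unfold numer
    nlinarith
  · intro b h0 h1 hb
    have hu : b < 71 / 100 := by
      refine root_lt_of_quadratic_neg ?_ ?_ h0 (by norm_num) hb ?_ <;> norm_num
    have hl : 69 / 100 < b := by
      refine lt_root_of_quadratic_pos ?_ ?_ h0 hb ?_ <;> norm_num
    have hc1 : 11 / 10 < numer 6 (9 / 8) b / (9 / 8 * b) := by
      rw [lt_div_iff₀ (by linarith)]
      unfold numer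
      nlinarith
    have hc2 : numer 6 (9 / 8) b / (9 / 8 * b) < 5 / 4 := by
      rw [div_lt_iff₀ (by linarith)]
      unfold numer
      nlinarith
    rw [max_eq_left (by linarith)]
    generalize numer 6 (9 / 8) b / (9 / 8 * b) = c at *
    unfold f1
    nlinarith [mul_pos (sub_pos.2 hc1) (sub_pos.2 hc2), mul_pos (sub_pos.2 hl) (sub_pos.2 hu),
      mul_pos (mul_pos (sub_pos.2 hc1) (sub_pos.2 hc2)) h0]

lemma eliminant_inv_add_two {u : ℝ} (hu : 0 < u) (a b : ℝ) :
    eliminant (u⁻¹ + 2) a b = u⁻¹ * ((4 * u - (1 + u) * a ^ 2) * b ^ 2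
      + 2 * a * (a - 1) * b + (a ^ 2 - 1) * ((1 + u) * a ^ 2 - 2 * a + 4 * u)) := by
  unfold eliminant
  field_simp
  ring

lemma numer_inv_add_two {u : ℝ} (hu : 0 < u) (a t : ℝ) :
    numer (u⁻¹ + 2) a (1 - t * u) = -a * t + a ^ 2 - 2 * (1 - t * u) ^ 2 + 2 := by
  unfold numer
  field_simp
  ring

lemma mul_pow_mul_pow_nonneg {x y z w : ℝ} (hx : 0 ≤ x) (hy : 0 ≤ y) (hz : 0 ≤ z) (hw : 0 ≤ w)
    (i j k l : ℕ) : 0 ≤ (x ^ i * y ^ j) * (z ^ k * w ^ l) := by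
  positivity

lemma eliminant_quarter_pos {u a : ℝ} (hu : 0 < u) (hu' : u ≤ 1 / 5)
    (ha : a ∈ Set.Icc (2 - 9 / 2 * u) (2 - 7 / 2 * u)) : 0 < eliminant (u⁻¹ + 2) a (1 / 4) := by
  obtain ⟨h1, h2⟩ := ha
  rw [eliminant_inv_add_two hu]
  refine mul_pos (inv_pos.2 hu) ?_
  obtain ⟨t, rfl⟩ : ∃ t, a = 2 - t * u := ⟨(2 - a) / u, by field_simp; ring⟩
  have ht1 : 7 / 2 ≤ t := by nlinarith
  have ht2 : t ≤ 9 / 2 := by nlinarith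
  have hT := mul_pow_mul_pow_nonneg hu.le (sub_nonneg.2 hu') 
    (sub_nonneg.2 ht1) (sub_nonneg.2 ht2)
  linarith [hT 0 5 0 4, hT 0 5 1 3, hT 0 5 2 2, hT 0 5 3 1, hT 0 5 4 0,
    hT 1 4 0 4, hT 1 4 1 3, hT 1 4 2 2, hT 1 4 3 1, hT 1 4 4 0,
    hT 2 3 0 4, hT 2 3 1 3, hT 2 3 2 2, hT 2 3 3 1, hT 2 3 4 0,
    hT 3 2 0 4, hT 3 2 1 3, hT 3 2 2 2, hT 3 2 3 1, hT 3 2 4 0,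
    hT 4 1 0 4, hT 4 1 1 3, hT 4 1 2 2, hT 4 1 3 1, hT 4 1 4 0,
    hT 5 0 0 4, hT 5 0 1 3, hT 5 0 2 2, hT 5 0 3 1, hT 5 0 4 0]

/-- At the right end of the interval, `x2` lies between `4/5` and `6/5`, where `f1` is negative. -/
lemma f1_neg_right {u t : ℝ} (hu : 0 < u) (hu' : u ≤ 1 / 5) (ht1 : 9 / 10 < t)
    (ht2 : t < 11 / 10) :
    f1 (u⁻¹ + 2) (max (numer (u⁻¹ + 2) (2 - 7 / 2 * u) (1 - t * u)
      / ((2 - 7 / 2 * u) * (1 - t * u))) 0) (2 - 7 / 2 * u) (1 - t * u) < 0 := by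
  have hT := mul_pow_mul_pow_nonneg hu.le (sub_nonneg.2 hu') 
    (sub_nonneg.2 ht1.le) (sub_nonneg.2 ht2.le)
  have htu : t * u < 1 := by nlinarith
  have hab : 0 < (2 - 7 / 2 * u) * (1 - t * u) := mul_pos (by linarith) (by linarith)
  have hc1 : 4 / 5 < numer (u⁻¹ + 2) (2 - 7 / 2 * u) (1 - t * u)
      / ((2 - 7 / 2 * u) * (1 - t * u)) := by
    rw [lt_div_iff₀ hab, numer_inv_add_two hu]
    linarith [hT 0 2 0 2, hT 0 2 1 1, hT 0 2 2 0,
      hT 1 1 0 2, hT 1 1 1 1, hT 1 1 2 0,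
      hT 2 0 0 2, hT 2 0 1 1, hT 2 0 2 0]
  have hc2 : numer (u⁻¹ + 2) (2 - 7 / 2 * u) (1 - t * u)
      / ((2 - 7 / 2 * u) * (1 - t * u)) < 6 / 5 := by
    rw [div_lt_iff₀ hab, numer_inv_add_two hu]
    linarith [hT 0 2 0 2, hT 0 2 1 1, hT 0 2 2 0,
      hT 1 1 0 2, hT 1 1 1 1, hT 1 1 2 0,
      hT 2 0 0 2, hT 2 0 1 1, hT 2 0 2 0]
  rw [max_eq_left (by linarith)]
  generalize numer (u⁻¹ + 2) (2 - 7 / 2 * u) (1 - t * u)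
    / ((2 - 7 / 2 * u) * (1 - t * u)) = c at *
  let Q : ℝ → ℝ := fun c => (1 - 2 * u) * (-(2 - 7 / 2 * u) ^ 3 * c
    + (2 - 7 / 2 * u) ^ 2 * (1 - t * u) * c ^ 2 + (2 - 7 / 2 * u) * (1 - t * u) ^ 2 * c
    + (2 - 7 / 2 * u) * c) - 2 * (2 - 7 / 2 * u) * (1 - t * u) * c
    + u * ((2 - 7 / 2 * u) ^ 2 * (1 - t * u) + 3 * (1 - t * u) * c ^ 2)
  have hQ1 : Q (4 / 5) < 0 := by
    simp only [Q]
    linarith [hT 0 4 0 2, hT 0 4 1 1, hT 0 4 2 0,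
      hT 1 3 0 2, hT 1 3 1 1, hT 1 3 2 0,
      hT 2 2 0 2, hT 2 2 1 1, hT 2 2 2 0,
      hT 3 1 0 2, hT 3 1 1 1, hT 3 1 2 0,
      hT 4 0 0 2, hT 4 0 1 1, hT 4 0 2 0]
  have hQ2 : Q (6 / 5) < 0 := by
    simp only [Q]
    linarith [hT 0 4 0 2, hT 0 4 1 1, hT 0 4 2 0,
      hT 1 3 0 2, hT 1 3 1 1, hT 1 3 2 0,
      hT 2 2 0 2, hT 2 2 1 1, hT 2 2 2 0,
      hT 3 1 0 2, hT 3 1 1 1, hT 3 1 2 0,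
      hT 4 0 0 2, hT 4 0 1 1, hT 4 0 2 0]
  have hlead : 0 < (1 - t * u) * ((1 - 2 * u) * (2 - 7 / 2 * u) ^ 2 + 3 * u) :=
    mul_pos (by linarith) (add_pos_of_nonneg_of_pos
      (mul_nonneg (by linarith) (sq_nonneg _)) (by linarith))
  have hconvex : 2 / 5 * Q c = (6 / 5 - c) * Q (4 / 5) + (c - 4 / 5) * Q (6 / 5)
      - 2 / 5 * ((1 - t * u) * ((1 - 2 * u) * (2 - 7 / 2 * u) ^ 2 + 3 * u)
        * ((c - 4 / 5) * (6 / 5 - c))) := by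
    simp only [Q]
    ring
  have hQ : Q c < 0 := by
    have h1 := mul_pos (sub_pos.2 hc2) (neg_pos.2 hQ1)
    have h2 := mul_pos (sub_pos.2 hc1) (neg_pos.2 hQ2)
    have h3 := mul_pos hlead (mul_pos (sub_pos.2 hc1) (sub_pos.2 hc2))
    linarith
  have hf : f1 (u⁻¹ + 2) c (2 - 7 / 2 * u) (1 - t * u) = u⁻¹ * Q c := by
    simp only [Q]
    unfold f1
    field_simp
    ring
  rw [hf]
  exact mul_neg_of_pos_of_neg (inv_pos.2 hu) hQ

/-- The case `n = u⁻¹ + 2 ≥ 7`, with `x12` between `2 - 9u/2` and `2 - 7u/2`. -/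
lemma exists_solution_large {u : ℝ} (hu : 0 < u) (hu' : u ≤ 1 / 5) :
    ∃ x2 x12 x13 : ℝ, 0 < x2 ∧ 0 < x12 ∧ 0 < x13 ∧ x13 < 1 ∧
      f1 (u⁻¹ + 2) x2 x12 x13 = 0 ∧ f2 (u⁻¹ + 2) x2 x12 x13 = 0 ∧
      f3 (u⁻¹ + 2) x2 x12 x13 = 0 := by
  have hm : 5 ≤ u⁻¹ := by rw [le_inv_comm₀ (by norm_num) hu]; linarith
  have hB : ∀ i j : ℕ, 0 ≤ u ^ i * (1 / 5 - u) ^ j := fun i j =>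
    mul_nonneg (pow_nonneg hu.le i) (pow_nonneg (by linarith) j)
  have hA : ∀ a, 1 < a → 4 - (u⁻¹ + 2 - 1) * a ^ 2 < 0 := fun a ha => by nlinarith
  have hneg : ∀ a ∈ Set.Icc (2 - 9 / 2 * u) (2 - 7 / 2 * u), eliminant (u⁻¹ + 2) a 1 < 0 := by
    rintro a ⟨h1, h2⟩
    have ha : 1 < a := by linarith
    have : eliminant (u⁻¹ + 2) a 1 = u⁻¹ * (a ^ 2 * ((1 + u) * a ^ 2 - 2 * a + 2 * u)) := by
      rw [eliminant_inv_add_two hu]; ring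
    rw [this]
    refine mul_neg_of_pos_of_neg (inv_pos.2 hu) (mul_neg_of_pos_of_neg (by positivity) ?_)
    nlinarith [mul_nonneg (sub_nonneg.2 h1) (sub_nonneg.2 h2), mul_pos hu hu,
      mul_pos hu (mul_pos hu hu)]
  refine exists_solution (lo := 2 - 9 / 2 * u) (hi := 2 - 7 / 2 * u) (s := 1 / 4) (by linarith)
    (by linarith) (by linarith) (by norm_num)
    (fun _ => eliminant_quarter_pos hu hu') hneg ?_ ?_
  · intro b h0 h1 hb
    have hbu : b < 1 - 5 / 2 * u := by
      refine root_lt_of_quadratic_neg (hA _ (by linarith))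
        (eliminant_quarter_pos hu hu' ⟨by linarith, by linarith⟩) h0 (by linarith) hb ?_
      change eliminant _ _ _ < 0
      rw [eliminant_inv_add_two hu]
      refine mul_neg_of_pos_of_neg (inv_pos.2 hu) ?_
      have h : -2 + 31 / 2 * u + 9 / 4 * u ^ 2 - 927 / 4 * u ^ 3 + 567 / 2 * u ^ 4 < 0 := by
        linarith [hB 0 4, hB 1 3, hB 2 2, hB 3 1, hB 4 0]
      nlinarith [mul_neg_of_pos_of_neg hu h]
    obtain ⟨t, rfl⟩ : ∃ t, b = 1 - t * u := ⟨(1 - b) / u, by field_simp; ring⟩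
    have ht : 5 / 2 < t := by nlinarith
    rw [numer_inv_add_two hu]
    nlinarith [mul_pos hu hu, mul_pos (sub_pos.2 ht) hu]
  · intro b h0 h1 hb
    have hpos' := eliminant_quarter_pos hu hu' (Set.right_mem_Icc.2 (by linarith))
    have hbu : b < 1 - 9 / 10 * u := by
      refine root_lt_of_quadratic_neg (hA _ (by linarith)) hpos' h0 (by linarith) hb ?_
      change eliminant _ _ _ < 0
      rw [eliminant_inv_add_two hu]
      refine mul_neg_of_pos_of_neg (inv_pos.2 hu) ?_
      have h : -2 / 5 - 127 / 50 * u + 4739 / 100 * u ^ 2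
          - 16947 / 100 * u ^ 3 + 7007 / 50 * u ^ 4 < 0 := by
        linarith [hB 0 4, hB 1 3, hB 2 2, hB 3 1, hB 4 0]
      nlinarith [mul_neg_of_pos_of_neg hu h]
    have hbl : 1 - 11 / 10 * u < b := by
      refine lt_root_of_quadratic_pos (hA _ (by linarith)) hpos' h0 hb ?_
      change 0 < eliminant _ _ _
      rw [eliminant_inv_add_two hu]
      refine mul_pos (inv_pos.2 hu) ?_
      have h : 0 < 2 / 5 - 277 / 50 * u + 4739 / 100 * u ^ 2
          - 16387 / 100 * u ^ 3 + 3381 / 25 * u ^ 4 := by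
        linarith [hB 0 4, hB 1 3, hB 2 2, hB 3 1, hB 4 0]
      nlinarith [mul_pos hu h]
    obtain ⟨t, rfl⟩ : ∃ t, b = 1 - t * u := ⟨(1 - b) / u, by field_simp; ring⟩
    exact f1_neg_right hu hu' (by nlinarith) (by nlinarith)

/-- For every integer `n ≥ 6` there is a solution of `f1 = f2 = f3 = 0` with
`x2, x12 > 0` and `0 < x13 < 1`. -/
theorem stmt2 (n : ℕ) (hn : 6 ≤ n) :
    ∃ x2 x12 x13 : ℝ, 0 < x2 ∧ 0 < x12 ∧ 0 < x13 ∧ x13 < 1 ∧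
      f1 n x2 x12 x13 = 0 ∧ f2 n x2 x12 x13 = 0 ∧ f3 n x2 x12 x13 = 0 := by
  obtain rfl | h := hn.eq_or_lt
  · exact_mod_cast exists_solution_six
  · have h7 : (7 : ℝ) ≤ n := by exact_mod_cast h
    have hu : (0 : ℝ) < ((n : ℝ) - 2)⁻¹ := inv_pos.2 (by linarith)
    have hu' : ((n : ℝ) - 2)⁻¹ ≤ 1 / 5 := by
      rw [inv_le_comm₀ (by linarith) (by norm_num)]
      linarith
    simpa only [inv_inv, sub_add_cancel] using exists_solution_large hu hu'
end

section
/- For every integer n ≥ 6 there exist positive real numbers x2, x12 and a real number x13 with 1 < x13 < 2 such that f1 = 0, f2 = 0 and f3 = 0. -/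
/-- Eliminating `x2` from `f2 = f3 = 0` leaves a quadratic equation in `t = x13`; these are its
coefficients for `x12 = s * e` and `n = 3 + 1 / e`. -/
def quadA (e s : ℝ) : ℝ := 4 - s ^ 2 * (e + 2 * e ^ 2)

/-- The linear coefficient of the quadratic equation in `x13`. -/
def quadB (e s : ℝ) : ℝ := 2 * (1 + e) * s * (s * e - 1)

/-- The constant coefficient of the quadratic equation in `x13`. -/
def quadC (e s : ℝ) : ℝ :=
  (s ^ 2 * e ^ 2 - 1) * (s ^ 2 * (e + 2 * e ^ 2) - 2 * (1 + e) * s + 4)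

/-- The value of `x12 * x13 * x2` forced by `f3 = 0`, in terms of `u = x13 - 1`. -/
def prodX (e s u : ℝ) : ℝ := (1 + e) * s * u + s ^ 2 * e ^ 2 - 4 * u - 2 * u ^ 2

/-- The factor multiplying `prodX` linearly in `reducedF1`. -/
def reducedCoeff (e s u : ℝ) : ℝ :=
  (e - e ^ 2) * (u ^ 2 - s ^ 2 * e ^ 2) - 4 * e ^ 2 * (1 + u)

/-- The polynomial `x12 ^ 2 * x13 * f1` after eliminating `x2` by `f3 = 0`. -/
def reducedF1 (e s u : ℝ) : ℝ :=
  prodX e s u ^ 2 * (s ^ 2 * (e - e ^ 2) + 3) + s ^ 2 * prodX e s u * reducedCoeff e s u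
    + s ^ 4 * e ^ 4 * (1 + u) ^ 2

/-- The larger root of the quadratic equation in `x13`. -/
noncomputable def quadRoot (e s : ℝ) : ℝ :=
  (-quadB e s + √(quadB e s ^ 2 - 4 * quadA e s * quadC e s)) / (2 * quadA e s)

lemma quadA_pos {e s : ℝ} (he : 0 < e) (he' : e ≤ 1 / 3) (hs : 3 / 2 ≤ s) (hs' : s ≤ 2) :
    0 < quadA e s := by
  unfold quadA
  have h1 : s ^ 2 ≤ 4 := by nlinarith
  have h2 : e + 2 * e ^ 2 ≤ 5 / 9 := by nlinarith
  nlinarith [mul_le_mul h1 h2 (by positivity) (by norm_num)]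

lemma quadC_neg {e s : ℝ} (he : 0 < e) (he' : e ≤ 1 / 3) (hs : 3 / 2 ≤ s) (hs' : s ≤ 2) :
    quadC e s < 0 := by
  unfold quadC
  have h1 : s * e ≤ 2 / 3 := by nlinarith
  have h2 : 0 < s * e := by nlinarith
  have h3 : 0 < s ^ 2 * (e + 2 * e ^ 2) - 2 * (1 + e) * s + 4 := by
    have key : s ^ 2 * (e + 2 * e ^ 2) - 2 * (1 + e) * s + 4
        = 8 * e ^ 2 + (2 - s) * (2 * (1 + e) - (s + 2) * (e + 2 * e ^ 2)) := by ring
    have h4 : (s + 2) * (e + 2 * e ^ 2) ≤ 4 * (e + 2 * e ^ 2) := by gcongr; linarith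
    have h5 : 0 ≤ 2 * (1 + e) - (s + 2) * (e + 2 * e ^ 2) := by nlinarith
    have h6 : 0 < e ^ 2 := by positivity
    linarith [mul_nonneg (sub_nonneg.2 hs') h5]
  refine mul_neg_of_neg_of_pos ?_ h3
  nlinarith

/-- A positive root of `A t² + B t + C` with `C < 0 < A` lies to the left of every positive point
where the quadratic is positive. -/
lemma lt_of_quadratic_pos {A B C t y : ℝ} (hA : 0 < A) (hC : C < 0) (ht : 0 < t)
    (h : A * t ^ 2 + B * t + C = 0) (hy : 0 < y) (hpos : 0 < A * y ^ 2 + B * y + C) : t < y := by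
  have key : t * (A * y ^ 2 + B * y + C) = (y - t) * (A * t * y - C) := by
    linear_combination y * h
  have h1 : 0 < A * t * y - C := by have := mul_pos (mul_pos hA ht) hy; linarith
  have h2 : 0 < (y - t) * (A * t * y - C) := key ▸ mul_pos ht hpos
  linarith [(pos_iff_pos_of_mul_pos h2).2 h1]

/-- A positive root of `A t² + B t + C` with `C < 0 < A` lies to the right of every positive point
where the quadratic is negative. -/
lemma lt_of_quadratic_neg {A B C t y : ℝ} (hA : 0 < A) (hC : C < 0) (ht : 0 < t)
    (h : A * t ^ 2 + B * t + C = 0) (hy : 0 < y) (hneg : A * y ^ 2 + B * y + C < 0) : y < t := by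
  have key : t * (A * y ^ 2 + B * y + C) = (y - t) * (A * t * y - C) := by
    linear_combination y * h
  have h1 : 0 < A * t * y - C := by have := mul_pos (mul_pos hA ht) hy; linarith
  by_contra! hcon
  nlinarith [mul_neg_of_pos_of_neg ht hneg, mul_nonneg (sub_nonneg.2 hcon) h1.le]

lemma quadRoot_spec {e s : ℝ} (he : 0 < e) (he' : e ≤ 1 / 3) (hs : 3 / 2 ≤ s) (hs' : s ≤ 2) :
    0 < quadRoot e s ∧
      quadA e s * quadRoot e s ^ 2 + quadB e s * quadRoot e s + quadC e s = 0 := by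
  have hA := quadA_pos he he' hs hs'
  have hC := quadC_neg he he' hs hs'
  have hAC : quadA e s * quadC e s < 0 := mul_neg_of_pos_of_neg hA hC
  unfold quadRoot
  generalize quadA e s = A at *
  generalize quadB e s = B at *
  generalize quadC e s = C at *
  have hD : B ^ 2 < B ^ 2 - 4 * A * C := by linarith
  have hsq := Real.sq_sqrt ((sq_nonneg B).trans hD.le)
  have hlt : B < √(B ^ 2 - 4 * A * C) := Real.lt_sqrt_of_sq_lt hD
  refine ⟨by apply div_pos <;> linarith, ?_⟩
  field_simp
  rw [mul_right_comm 4 A C] at hsq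
  ring_nf at hsq ⊢
  linear_combination hsq

lemma quadRoot_bounds {e s : ℝ} (he : 0 < e) (he' : e ≤ 1 / 3) (hs : 3 / 2 ≤ s) (hs' : s ≤ 2) :
    1 < quadRoot e s ∧ quadRoot e s < 1 + s * e := by
  have hA := quadA_pos he he' hs hs'
  have hC := quadC_neg he he' hs hs'
  obtain ⟨ht, h⟩ := quadRoot_spec he he' hs hs'
  have hse : 0 < s * e := mul_pos (by linarith) he
  constructor
  · refine lt_of_quadratic_neg hA hC ht h one_pos ?_
    have : quadA e s * 1 ^ 2 + quadB e s * 1 + quadC e s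
        = s ^ 2 * e ^ 2 * (s ^ 2 * (e + 2 * e ^ 2) - 2 * (1 + e) * s + 2) := by
      unfold quadA quadB quadC; ring
    rw [this]
    refine mul_neg_of_pos_of_neg (by positivity) ?_
    have h1 : s ^ 2 ≤ 7 / 2 * s - 3 := by nlinarith
    have h2 : s ^ 2 * (e + 2 * e ^ 2) ≤ (7 / 2 * s - 3) * (e + 2 * e ^ 2) := by gcongr
    nlinarith
  · refine lt_of_quadratic_pos hA hC ht h (by linarith) ?_
    have : quadA e s * (1 + s * e) ^ 2 + quadB e s * (1 + s * e) + quadC e s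
        = 2 * (1 + s * e) * (s * e * (4 - s * (1 + 2 * e))) := by
      unfold quadA quadB quadC; ring
    rw [this]
    have : 0 < 4 - s * (1 + 2 * e) := by nlinarith
    positivity

lemma quadRoot_bounds_left {e : ℝ} (he : 0 < e) (he' : e ≤ 1 / 3) :
    1 + 2 / 5 * e ^ 2 < quadRoot e (3 / 2) ∧ quadRoot e (3 / 2) < 1 + 11 / 20 * e ^ 2 := by
  have hA := quadA_pos he he' le_rfl (by norm_num)
  have hC := quadC_neg he he' le_rfl (by norm_num)
  obtain ⟨ht, h⟩ := quadRoot_spec he he' le_rfl (by norm_num)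
  constructor
  · refine lt_of_quadratic_neg hA hC ht h (by positivity) ?_
    have : quadA e (3 / 2) * (1 + 2 / 5 * e ^ 2) ^ 2 + quadB e (3 / 2) * (1 + 2 / 5 * e ^ 2) + quadC e (3 / 2)
        = e ^ 2 * (-1 / 4 - 231 / 80 * e + 1793 / 200 * e ^ 2 - 9 / 25 * e ^ 3 - 18 / 25 * e ^ 4) := by
      unfold quadA quadB quadC; ring
    rw [this]
    refine mul_neg_of_pos_of_neg (by positivity) ?_
    nlinarith [mul_pos he he, pow_pos he 3, pow_pos he 4, mul_nonneg he.le (sub_nonneg.2 he')]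
  · refine lt_of_quadratic_pos hA hC ht h (by positivity) ?_
    have : quadA e (3 / 2) * (1 + 11 / 20 * e ^ 2) ^ 2 + quadB e (3 / 2) * (1 + 11 / 20 * e ^ 2) + quadC e (3 / 2)
        = e ^ 2 * (1 / 2 - 267 / 80 * e + 443 / 50 * e ^ 2 - 1089 / 1600 * e ^ 3
          - 1089 / 800 * e ^ 4) := by
      unfold quadA quadB quadC; ring
    rw [this]
    refine mul_pos (by positivity) ?_
    nlinarith [sq_nonneg (e - 1 / 5), pow_pos he 2, mul_nonneg (pow_nonneg he.le 2) (sub_nonneg.2 he'),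
      mul_nonneg (pow_nonneg he.le 3) (sub_nonneg.2 he')]

lemma quadRoot_bounds_right {e : ℝ} (he : 0 < e) (he' : e ≤ 1 / 3) :
    1 + 2 * e ^ 2 < quadRoot e 2 ∧ quadRoot e 2 < 1 + 11 / 5 * e ^ 2 := by
  have hA := quadA_pos he he' (by norm_num) le_rfl
  have hC := quadC_neg he he' (by norm_num) le_rfl
  obtain ⟨ht, h⟩ := quadRoot_spec he he' (by norm_num) le_rfl
  constructor
  · refine lt_of_quadratic_neg hA hC ht h (by positivity) ?_
    have : quadA e 2 * (1 + 2 * e ^ 2) ^ 2 + quadB e 2 * (1 + 2 * e ^ 2) + quadC e 2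
        = e ^ 3 * (-8 + 32 * e - 16 * e ^ 2 - 32 * e ^ 3) := by
      unfold quadA quadB quadC; ring
    rw [this]
    refine mul_neg_of_pos_of_neg (by positivity) ?_
    nlinarith [mul_nonneg he.le (sq_nonneg (e - 1 / 3)), sq_nonneg (e - 1 / 3)]
  · refine lt_of_quadratic_pos hA hC ht h (by positivity) ?_
    have : quadA e 2 * (1 + 11 / 5 * e ^ 2) ^ 2 + quadB e 2 * (1 + 11 / 5 * e ^ 2) + quadC e 2
        = e ^ 2 * (4 / 5 - 44 / 5 * e + 844 / 25 * e ^ 2 - 484 / 25 * e ^ 3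
          - 968 / 25 * e ^ 4) := by
      unfold quadA quadB quadC; ring
    rw [this]
    refine mul_pos (by positivity) ?_
    nlinarith [sq_nonneg (e - 4 / 25), mul_nonneg (pow_nonneg he.le 2) (sub_nonneg.2 he'),
      mul_nonneg (pow_nonneg he.le 3) (sub_nonneg.2 he'), mul_nonneg he.le (sq_nonneg (e - 4 / 25)),
      sq_nonneg (e * (e - 4 / 25)), mul_nonneg (sq_nonneg (e - 4 / 25)) (sub_nonneg.2 he')]

lemma reducedF1_left_neg {e v : ℝ} (he : 0 < e) (he' : e ≤ 1 / 3) (hv : 2 / 5 ≤ v)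
    (hv' : v ≤ 11 / 20) : reducedF1 e (3 / 2) (v * e ^ 2) < 0 := by
  obtain ⟨p, hp⟩ : ∃ p, p = 9 / 4 + v * (-5 / 2 + 3 / 2 * e - 2 * v * e ^ 2) := ⟨_, rfl⟩
  have hP : prodX e (3 / 2) (v * e ^ 2) = e ^ 2 * p := by rw [hp, prodX]; ring
  have hve : v * e ≤ 11 / 60 := by nlinarith
  have hve0 : 0 < v * e := by nlinarith
  have hp1 : 7 / 8 ≤ p := by rw [hp]; nlinarith
  have hp2 : p ≤ 3 / 2 := by rw [hp]; nlinarith [sq_nonneg (v * e)]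
  have key : reducedF1 e (3 / 2) (v * e ^ 2) = e ^ 4 * (3 * (p - 3 / 4) * (p - 9 / 4)
      - 9 / 4 * (e - e ^ 2) * p * (9 / 4 - p) + v * e ^ 2 * (81 / 8 - 9 * p)
      + (v * e) ^ 2 * (9 / 4 * p * (1 - e) * e + 81 / 16 * e ^ 2)) := by
    rw [reducedF1, hP, reducedCoeff]; ring
  rw [key]
  refine mul_neg_of_pos_of_neg (by positivity) ?_
  have h1 : 3 * (p - 3 / 4) * (p - 9 / 4) ≤ -1 / 2 := by nlinarith
  have h2 : 0 ≤ 9 / 4 * (e - e ^ 2) * p * (9 / 4 - p) := by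
    have : 0 < e - e ^ 2 := by nlinarith
    have : 0 < 9 / 4 - p := by linarith
    positivity
  have h3 : v * e ^ 2 * (81 / 8 - 9 * p) ≤ 11 / 180 * (9 / 4) := by
    have : v * e ^ 2 ≤ 11 / 180 := by nlinarith
    have h0 : 0 < v * e ^ 2 := by nlinarith
    nlinarith
  have h4 : (v * e) ^ 2 * (9 / 4 * p * (1 - e) * e + 81 / 16 * e ^ 2) ≤ (11 / 60) ^ 2 * 3 := by
    have hpe : p * (1 - e) ≤ 3 / 2 := by nlinarith
    have hpe0 : 0 ≤ p * (1 - e) := by apply mul_nonneg <;> linarith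
    gcongr
    · nlinarith
    · nlinarith
  linarith

lemma reducedF1_right_pos {e v : ℝ} (he : 0 < e) (he' : e ≤ 1 / 3) (hv : 2 ≤ v)
    (hv' : v ≤ 11 / 5) : 0 < reducedF1 e 2 (v * e ^ 2) := by
  obtain ⟨p, hp⟩ : ∃ p, p = 4 - 2 * v * (1 - e + v * e ^ 2) := ⟨_, rfl⟩
  obtain ⟨q, hq⟩ : ∃ q, q = (1 - e) * (4 * e - v ^ 2 * e ^ 3) + 4 + 4 * v * e ^ 2 := ⟨_, rfl⟩
  have hP : prodX e 2 (v * e ^ 2) = e ^ 2 * p := by rw [hp, prodX]; ring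
  have hp1 : p ≤ 1 / 2 := by
    have h1 : 2 * (1 - e + 2 * e ^ 2) ≤ v * (1 - e + v * e ^ 2) := by
      have : 1 - e + 2 * e ^ 2 ≤ 1 - e + v * e ^ 2 := by nlinarith [sq_nonneg e]
      exact mul_le_mul hv this (by nlinarith) (by linarith)
    nlinarith [sq_nonneg (e - 1 / 4)]
  have hve : v * e ≤ 11 / 15 := by nlinarith
  have hve0 : 0 < v * e := by nlinarith
  have hq0 : 0 ≤ q := by
    rw [hq]
    have : 0 ≤ 4 * e - v ^ 2 * e ^ 3 := by nlinarith [mul_pos hve0 hve0]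
    have : 0 ≤ 1 - e := by linarith
    positivity
  have hq1 : q ≤ 6 := by
    rw [hq]
    have : (1 - e) * (4 * e - v ^ 2 * e ^ 3) ≤ (1 - e) * (4 * e) := by
      apply mul_le_mul_of_nonneg_left _ (by linarith)
      have : 0 ≤ v ^ 2 * e ^ 3 := by positivity
      linarith
    nlinarith
  have key : reducedF1 e 2 (v * e ^ 2) = e ^ 4 * (p ^ 2 * (4 * (e - e ^ 2) + 3)
      - 4 * p * q + 16 * (1 + v * e ^ 2) ^ 2) := by
    rw [reducedF1, hP, reducedCoeff, hq]; ring
  rw [key]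
  have h1 : 0 ≤ p ^ 2 * (4 * (e - e ^ 2) + 3) := mul_nonneg (sq_nonneg p) (by nlinarith)
  have h2 : 1 ≤ (1 + v * e ^ 2) ^ 2 := by
    have : 0 ≤ v * e ^ 2 := by positivity
    nlinarith
  have h3 : p * q ≤ 3 := by nlinarith
  have : 0 < p ^ 2 * (4 * (e - e ^ 2) + 3) - 4 * p * q + 16 * (1 + v * e ^ 2) ^ 2 := by linarith
  positivity

lemma continuousOn_quadRoot {e : ℝ} (he : 0 < e) (he' : e ≤ 1 / 3) :
    ContinuousOn (quadRoot e) (Set.Icc (3 / 2) 2) := by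
  have hA : Continuous (quadA e) := by unfold quadA; fun_prop
  have hB : Continuous (quadB e) := by unfold quadB; fun_prop
  have hC : Continuous (quadC e) := by unfold quadC; fun_prop
  unfold quadRoot
  refine ContinuousOn.div (by fun_prop) (by fun_prop) fun s hs => ?_
  have := quadA_pos he he' hs.1 hs.2
  positivity

lemma exists_reducedF1_eq_zero {e : ℝ} (he : 0 < e) (he' : e ≤ 1 / 3) :
    ∃ s ∈ Set.Icc (3 / 2 : ℝ) 2, reducedF1 e s (quadRoot e s - 1) = 0 := by
  have hcont : ContinuousOn (fun s => reducedF1 e s (quadRoot e s - 1)) (Set.Icc (3 / 2) 2) := by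
    have := continuousOn_quadRoot he he'
    unfold reducedF1 reducedCoeff prodX
    fun_prop
  have hmul (t : ℝ) : t - 1 = (t - 1) / e ^ 2 * e ^ 2 := by field_simp
  have he2 : 0 < e ^ 2 := by positivity
  have hleft : reducedF1 e (3 / 2) (quadRoot e (3 / 2) - 1) ≤ 0 := by
    obtain ⟨h1, h2⟩ := quadRoot_bounds_left he he'
    rw [hmul]
    refine (reducedF1_left_neg he he' ?_ ?_).le
    · rw [le_div_iff₀ he2]; linarith
    · rw [div_le_iff₀ he2]; linarith
  have hright : 0 ≤ reducedF1 e 2 (quadRoot e 2 - 1) := by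
    obtain ⟨h1, h2⟩ := quadRoot_bounds_right he he'
    rw [hmul]
    refine (reducedF1_right_pos he he' ?_ ?_).le
    · rw [le_div_iff₀ he2]; linarith
    · rw [div_le_iff₀ he2]; linarith
  exact intermediate_value_Icc (by norm_num) hcont ⟨hleft, hright⟩

lemma prodX_pos {e s u : ℝ} (he : 0 < e) (he' : e ≤ 1 / 3) (hs : 0 < s) (hu : 0 < u)
    (hus : u ≤ s * e) (h : reducedF1 e s u = 0) : 0 < prodX e s u := by
  have hR : reducedCoeff e s u ≤ 0 := by
    unfold reducedCoeff
    have h1 : u ^ 2 - s ^ 2 * e ^ 2 ≤ 0 := by nlinarith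
    have h2 : 0 ≤ e - e ^ 2 := by nlinarith
    have h3 : 0 ≤ 4 * e ^ 2 * (1 + u) := by positivity
    linarith [mul_nonpos_of_nonneg_of_nonpos h2 h1]
  by_contra! hP
  have h1 : 0 ≤ s ^ 2 * prodX e s u * reducedCoeff e s u := by
    rw [mul_assoc]; exact mul_nonneg (sq_nonneg s) (mul_nonneg_of_nonpos_of_nonpos hP hR)
  have h2 : 0 ≤ prodX e s u ^ 2 * (s ^ 2 * (e - e ^ 2) + 3) := by
    have : 0 ≤ e - e ^ 2 := by nlinarith
    positivity
  have h3 : 0 < s ^ 4 * e ^ 4 * (1 + u) ^ 2 := by positivity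
  unfold reducedF1 at h
  linarith

/-- For every integer `n ≥ 6` there is a solution of `f1 = f2 = f3 = 0` with
`x2, x12 > 0` and `1 < x13 < 2`. -/
theorem stmt3 (n : ℕ) (hn : 6 ≤ n) :
    ∃ x2 x12 x13 : ℝ, 0 < x2 ∧ 0 < x12 ∧ 1 < x13 ∧ x13 < 2 ∧
      f1 n x2 x12 x13 = 0 ∧ f2 n x2 x12 x13 = 0 ∧ f3 n x2 x12 x13 = 0 := by
  have hn' : (6 : ℝ) ≤ n := by exact_mod_cast hn
  obtain ⟨e, hedef⟩ : ∃ e : ℝ, e = 1 / (n - 3) := ⟨_, rfl⟩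
  have he : 0 < e := by rw [hedef]; apply one_div_pos.2; linarith
  have he' : e ≤ 1 / 3 := by
    rw [hedef]; exact one_div_le_one_div_of_le (by norm_num) (by linarith)
  have hne : (n : ℝ) = 3 + 1 / e := by rw [hedef, one_div_one_div]; ring
  obtain ⟨s, ⟨hs, hs'⟩, hF⟩ := exists_reducedF1_eq_zero he he'
  obtain ⟨-, hq⟩ := quadRoot_spec he he' hs hs'
  obtain ⟨ht, hts⟩ := quadRoot_bounds he he' hs hs'
  have hs0 : 0 < s := by linarith
  have hP := prodX_pos he he' hs0 (sub_pos.2 ht) (by linarith) hF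
  generalize quadRoot e s = t at *
  have ht0 : 0 < t := by linarith
  refine ⟨prodX e s (t - 1) / (s * e * t), s * e, t, by positivity, by positivity, ht,
    by nlinarith, ?_, ?_, ?_⟩
  · rw [hne, f1]
    unfold reducedF1 reducedCoeff at hF
    field_simp
    unfold prodX at *
    linear_combination hF
  · rw [hne, f2]
    unfold quadA quadB quadC at hq
    unfold prodX
    field_simp
    linear_combination hq
  · rw [hne, f3, prodX]
    field_simp
    ring
end

section
/- For every integer n ≥ 6, every real solution (x2, x12, x13) of the system f1 = 0, f2 = 0, f3 = 0 with x2 · x12 · x13 · (x13 − 1) ≠ 0 satisfies x12 > 0 and x2 > 0. -/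
/-- With `x2` eliminated through `f3`, the equation `f2 = 0` is quadratic in `x13`. -/
lemma quadratic_of_f2_f3 {d s a b : ℝ} (h2 : f2 (d + 6) s a b = 0) (h3 : f3 (d + 6) s a b = 0) :
    (4 - (d + 5) * a ^ 2) * b ^ 2 + 2 * (d + 4) * a * (a - 1) * b
        + (a ^ 2 - 1) * ((d + 5) * a ^ 2 - 2 * (d + 4) * a + 4) = 0 := by
  unfold f2 at h2
  unfold f3 at h3
  linear_combination a * h2 + 2 * (a ^ 2 - 1) * h3

/-- With `x2` eliminated through `f3`, the equation `f1 = 0` is divisible by `x13 - 1`, and the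
quotient is cubic in `x13`. -/
lemma cubic_of_f1_f3 {d s a b : ℝ} (h1 : f1 (d + 6) s a b = 0) (h3 : f3 (d + 6) s a b = 0)
    (hb : b ≠ 1) :
    ((2 * d + 4) * a ^ 2 + 12) * b ^ 3 + ((-3 * d ^ 2 - 18 * d - 24) * a ^ 3 + (6 * d
      + 20) * a ^ 2 + (-12 * d - 48) * a + 12) * b ^ 2 + ((d ^ 3 + 10 * d ^ 2 + 31 * d
      + 31) * a ^ 4 + (-2 * d ^ 2 - 16 * d - 32) * a ^ 3 + (3 * d ^ 2 + 22 * d + 40) * a ^ 2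
      - 12) * b + (d ^ 2 + 6 * d + 8) * a ^ 5 + (-d ^ 3 - 10 * d ^ 2 - 35 * d - 41) * a ^ 4
      + (5 * d ^ 2 + 36 * d + 64) * a ^ 3 + (-3 * d ^ 2 - 30 * d - 72) * a ^ 2 + (12 * d
      + 48) * a - 12 = 0 := by
  unfold f1 at h1
  unfold f3 at h3
  refine (mul_eq_zero.mp ?_).resolve_left (sub_ne_zero.mpr hb)
  linear_combination a ^ 2 * b * h1
    + (((d + 2) * a ^ 2 + 3) * ((d + 4) * a * (b - 1) + a ^ 2 - 2 * (b ^ 2 - 1) + a * b * s)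
      + a ^ 2 * ((d + 2) * (1 + b ^ 2 - a ^ 2) - 2 * (d + 4) * b)) * h3

/-- The resultant in `b` of the quadratic and the cubic satisfied by `x13`, up to the factor
`a ^ 4`. -/
lemma resultant_eq_zero {d a b : ℝ} (ha : a ≠ 0)
    (hP : (4 - (d + 5) * a ^ 2) * b ^ 2 + 2 * (d + 4) * a * (a - 1) * b
        + (a ^ 2 - 1) * ((d + 5) * a ^ 2 - 2 * (d + 4) * a + 4) = 0)
    (hQ :
      ((2 * d + 4) * a ^ 2 + 12) * b ^ 3 + ((-3 * d ^ 2 - 18 * d - 24) * a ^ 3 + (6 * d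
        + 20) * a ^ 2 + (-12 * d - 48) * a + 12) * b ^ 2 + ((d ^ 3 + 10 * d ^ 2 + 31 * d
        + 31) * a ^ 4 + (-2 * d ^ 2 - 16 * d - 32) * a ^ 3 + (3 * d ^ 2 + 22 * d + 40) * a ^ 2
        - 12) * b + (d ^ 2 + 6 * d + 8) * a ^ 5 + (-d ^ 3 - 10 * d ^ 2 - 35 * d - 41) * a ^ 4
        + (5 * d ^ 2 + 36 * d + 64) * a ^ 3 + (-3 * d ^ 2 - 30 * d - 72) * a ^ 2 + (12 * d
        + 48) * a - 12 = 0) :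
    (d ^ 9 + 35 * d ^ 8 + 537 * d ^ 7 + 4737 * d ^ 6 + 26461 * d ^ 5 + 97041 * d ^ 4
      + 233684 * d ^ 3 + 356610 * d ^ 2 + 313425 * d + 121125) * a ^ 10 + (-2 * d ^ 9
      - 84 * d ^ 8 - 1502 * d ^ 7 - 15140 * d ^ 6 - 95326 * d ^ 5 - 390220 * d ^ 4
      - 1041324 * d ^ 3 - 1750632 * d ^ 2 - 1685770 * d - 709800) * a ^ 9 + (40 * d ^ 8
      + 1298 * d ^ 7 + 18170 * d ^ 6 + 143358 * d ^ 5 + 697430 * d ^ 4 + 2142896 * d ^ 3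
      + 4062358 * d ^ 2 + 4346776 * d + 2011930) * a ^ 8 + (-8 * d ^ 8 - 588 * d ^ 7
      - 12440 * d ^ 6 - 129024 * d ^ 5 - 769348 * d ^ 4 - 2779844 * d ^ 3 - 6032980 * d ^ 2
      - 7254616 * d - 3723552) * a ^ 7 + (145 * d ^ 7 + 5403 * d ^ 6 + 77859 * d ^ 5
      + 586017 * d ^ 4 + 2536504 * d ^ 3 + 6381392 * d ^ 2 + 8697776 * d + 4977456) * a ^ 6
      + (-6 * d ^ 7 - 1256 * d ^ 6 - 30190 * d ^ 5 - 307676 * d ^ 4 - 1651664 * d ^ 3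
      - 4910448 * d ^ 2 - 7669936 * d - 4922304) * a ^ 5 + (106 * d ^ 6 + 6688 * d ^ 5
      + 105350 * d ^ 4 + 744784 * d ^ 3 + 2701968 * d ^ 2 + 4926464 * d + 3584448) * a ^ 4
      + (-736 * d ^ 5 - 22336 * d ^ 4 - 225744 * d ^ 3 - 1041184 * d ^ 2 - 2268928 * d
      - 1900032) * a ^ 3 + (2496 * d ^ 4 + 43712 * d ^ 3 + 273280 * d ^ 2 + 733376 * d
      + 719296) * a ^ 2 + (-4096 * d ^ 3 - 43520 * d ^ 2 - 154112 * d - 182272) * a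
      + 2560 * d ^ 2 + 15360 * d + 23680 = 0 := by
  refine (mul_eq_zero.mp ?_).resolve_left (pow_ne_zero 4 ha)
  linear_combination
    (
      ((2 * d ^ 6 + 44 * d ^ 5 + 396 * d ^ 4 + 1862 * d ^ 3 + 4810 * d ^ 2 + 6450 * d
        + 3500) * a ^ 8 + (-16 * d ^ 5 - 292 * d ^ 4 - 2076 * d ^ 3 - 7160 * d ^ 2 - 11936 * d
        - 7680) * a ^ 7 + (14 * d ^ 5 + 324 * d ^ 4 + 2846 * d ^ 3 + 11960 * d ^ 2 + 24052 * d
        + 18404) * a ^ 6 + (-112 * d ^ 4 - 1864 * d ^ 3 - 11400 * d ^ 2 - 30080 * d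
        - 28544) * a ^ 5 + (12 * d ^ 4 + 512 * d ^ 3 + 5012 * d ^ 2 + 18912 * d + 24704) * a ^ 4
        + (-96 * d ^ 3 - 1440 * d ^ 2 - 7968 * d - 14976) * a ^ 3 + (192 * d ^ 2 + 928 * d
        + 2336) * a ^ 2 + (1152 * d + 4608) * a - 1920) * b ^ 2 + ((-3 * d ^ 7 - 78 * d ^ 6
        - 854 * d ^ 5 - 5097 * d ^ 4 - 17887 * d ^ 3 - 36871 * d ^ 2 - 41310 * d
        - 19400) * a ^ 9 + (32 * d ^ 6 + 706 * d ^ 5 + 6390 * d ^ 4 + 30336 * d ^ 3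
        + 79576 * d ^ 2 + 109220 * d + 61200) * a ^ 8 + (-15 * d ^ 6 - 490 * d ^ 5
        - 5913 * d ^ 4 - 35378 * d ^ 3 - 112976 * d ^ 2 - 184428 * d - 120880) * a ^ 7
        + (152 * d ^ 5 + 3232 * d ^ 4 + 26768 * d ^ 3 + 108264 * d ^ 2 + 214184 * d
        + 165920) * a ^ 6 + (-12 * d ^ 5 - 832 * d ^ 4 - 11148 * d ^ 3 - 61536 * d ^ 2
        - 154536 * d - 146336) * a ^ 5 + (120 * d ^ 4 + 2816 * d ^ 3 + 21960 * d ^ 2 + 71328 * d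
        + 83456) * a ^ 4 + (-384 * d ^ 3 - 4384 * d ^ 2 - 17376 * d - 23936) * a ^ 3
        + (-192 * d ^ 2 - 1984 * d - 4864) * a ^ 2 + (960 * d + 3840) * a) * b + (d ^ 8
        + 30 * d ^ 7 + 385 * d ^ 6 + 2758 * d ^ 5 + 12057 * d ^ 4 + 32954 * d ^ 3
        + 55106 * d ^ 2 + 51760 * d + 21025) * a ^ 10 + (-13 * d ^ 7 - 330 * d ^ 6
        - 3530 * d ^ 5 - 20619 * d ^ 4 - 71033 * d ^ 3 - 144453 * d ^ 2 - 160882 * d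
        - 75960) * a ^ 9 + (4 * d ^ 7 + 180 * d ^ 6 + 2732 * d ^ 5 + 20530 * d ^ 4
        + 86120 * d ^ 3 + 205864 * d ^ 2 + 263034 * d + 140156) * a ^ 8 + (-49 * d ^ 6
        - 1292 * d ^ 5 - 13269 * d ^ 4 - 69222 * d ^ 3 - 195512 * d ^ 2 - 285700 * d
        - 170256) * a ^ 7 + (3 * d ^ 6 + 314 * d ^ 5 + 5185 * d ^ 4 + 35722 * d ^ 3
        + 121760 * d ^ 2 + 202980 * d + 131900) * a ^ 6 + (-36 * d ^ 5 - 1232 * d ^ 4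
        - 11972 * d ^ 3 - 49320 * d ^ 2 - 89144 * d - 55136) * a ^ 5 + (156 * d ^ 4
        + 2592 * d ^ 3 + 13220 * d ^ 2 + 22848 * d + 5312) * a ^ 4 + (-288 * d ^ 3
        - 2624 * d ^ 2 - 5952 * d - 256) * a ^ 3 + (768 * d ^ 2 + 5664 * d + 10272) * a ^ 2
        + (-2112 * d - 8448) * a + 1920) * hP
    + (
      ((d ^ 6 + 25 * d ^ 5 + 258 * d ^ 4 + 1405 * d ^ 3 + 4250 * d ^ 2 + 6750 * d
        + 4375) * a ^ 8 + (-8 * d ^ 5 - 170 * d ^ 4 - 1428 * d ^ 3 - 5914 * d ^ 2 - 12040 * d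
        - 9600) * a ^ 7 + (-3 * d ^ 5 - 35 * d ^ 4 - 37 * d ^ 3 + 1015 * d ^ 2 + 4776 * d
        + 6380) * a ^ 6 + (24 * d ^ 4 + 344 * d ^ 3 + 1672 * d ^ 2 + 2920 * d + 800) * a ^ 5
        + (-4 * d ^ 4 - 144 * d ^ 3 - 1396 * d ^ 2 - 5232 * d - 6664) * a ^ 4 + (32 * d ^ 3
        + 640 * d ^ 2 + 3904 * d + 7424) * a ^ 3 + (-64 * d ^ 2 - 576 * d - 1792) * a ^ 2
        + (-384 * d - 1536) * a + 640) * b + (2 * d ^ 5 + 42 * d ^ 4 + 346 * d ^ 3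
        + 1390 * d ^ 2 + 2700 * d + 2000) * a ^ 9 + (-d ^ 6 - 29 * d ^ 5 - 346 * d ^ 4
        - 2169 * d ^ 3 - 7514 * d ^ 2 - 13590 * d - 9975) * a ^ 8 + (2 * d ^ 6 + 56 * d ^ 5
        + 662 * d ^ 4 + 4212 * d ^ 3 + 15160 * d ^ 2 + 29188 * d + 23440) * a ^ 7 + (-21 * d ^ 5
        - 431 * d ^ 4 - 3607 * d ^ 3 - 15505 * d ^ 2 - 34384 * d - 31468) * a ^ 6 + (2 * d ^ 5
        + 128 * d ^ 4 + 1646 * d ^ 3 + 8928 * d ^ 2 + 22784 * d + 22912) * a ^ 5 + (-20 * d ^ 4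
        - 432 * d ^ 3 - 2788 * d ^ 2 - 6832 * d - 5368) * a ^ 4 + (64 * d ^ 3 + 448 * d ^ 2
        - 32 * d - 3200) * a ^ 3 + (-64 * d ^ 2 - 192 * d + 768) * a ^ 2 + (384 * d + 1536) * a
        - 640) * hQ

/-- The resultant has coefficients of alternating sign, hence no root `-t` with `0 < t`. -/
lemma resultant_neg_pos {d t : ℝ} (hd : 0 ≤ d) (ht : 0 < t) :
    0 <
    (d ^ 9 + 35 * d ^ 8 + 537 * d ^ 7 + 4737 * d ^ 6 + 26461 * d ^ 5 + 97041 * d ^ 4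
      + 233684 * d ^ 3 + 356610 * d ^ 2 + 313425 * d + 121125) * t ^ 10 + (2 * d ^ 9
      + 84 * d ^ 8 + 1502 * d ^ 7 + 15140 * d ^ 6 + 95326 * d ^ 5 + 390220 * d ^ 4
      + 1041324 * d ^ 3 + 1750632 * d ^ 2 + 1685770 * d + 709800) * t ^ 9 + (40 * d ^ 8
      + 1298 * d ^ 7 + 18170 * d ^ 6 + 143358 * d ^ 5 + 697430 * d ^ 4 + 2142896 * d ^ 3
      + 4062358 * d ^ 2 + 4346776 * d + 2011930) * t ^ 8 + (8 * d ^ 8 + 588 * d ^ 7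
      + 12440 * d ^ 6 + 129024 * d ^ 5 + 769348 * d ^ 4 + 2779844 * d ^ 3 + 6032980 * d ^ 2
      + 7254616 * d + 3723552) * t ^ 7 + (145 * d ^ 7 + 5403 * d ^ 6 + 77859 * d ^ 5
      + 586017 * d ^ 4 + 2536504 * d ^ 3 + 6381392 * d ^ 2 + 8697776 * d + 4977456) * t ^ 6
      + (6 * d ^ 7 + 1256 * d ^ 6 + 30190 * d ^ 5 + 307676 * d ^ 4 + 1651664 * d ^ 3
      + 4910448 * d ^ 2 + 7669936 * d + 4922304) * t ^ 5 + (106 * d ^ 6 + 6688 * d ^ 5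
      + 105350 * d ^ 4 + 744784 * d ^ 3 + 2701968 * d ^ 2 + 4926464 * d + 3584448) * t ^ 4
      + (736 * d ^ 5 + 22336 * d ^ 4 + 225744 * d ^ 3 + 1041184 * d ^ 2 + 2268928 * d
      + 1900032) * t ^ 3 + (2496 * d ^ 4 + 43712 * d ^ 3 + 273280 * d ^ 2 + 733376 * d
      + 719296) * t ^ 2 + (4096 * d ^ 3 + 43520 * d ^ 2 + 154112 * d + 182272) * t
      + 2560 * d ^ 2 + 15360 * d + 23680 := by
  positivity

lemma x12_pos {d s a b : ℝ} (hd : 0 ≤ d) (h1 : f1 (d + 6) s a b = 0)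
    (h2 : f2 (d + 6) s a b = 0) (h3 : f3 (d + 6) s a b = 0) (ha : a ≠ 0) (hb : b ≠ 1) :
    0 < a := by
  by_contra hna
  have ht : 0 < -a := neg_pos.mpr (lt_of_le_of_ne (not_lt.mp hna) ha)
  have hres := resultant_eq_zero ha (quadratic_of_f2_f3 h2 h3) (cubic_of_f1_f3 h1 h3 hb)
  refine (resultant_neg_pos hd ht).ne' ?_
  linear_combination hres

/-- The combination `f1 + x2 * f2` of the Einstein equations. -/
lemma f1_add_mul_f2 {d s a b : ℝ} (h1 : f1 (d + 6) s a b = 0) (h2 : f2 (d + 6) s a b = 0) :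
    b * s ^ 2 * ((d + 4) * a ^ 2 + 1) + a * s * (b ^ 2 - 1 + a ^ 2 - 2 * (d + 4) * a * b)
      + b * a ^ 2 = 0 := by
  unfold f1 at h1
  unfold f2 at h2
  linear_combination h1 + s * h2

lemma x2_pos {d s a b : ℝ} (hd : 0 ≤ d) (h1 : f1 (d + 6) s a b = 0)
    (h2 : f2 (d + 6) s a b = 0) (h3 : f3 (d + 6) s a b = 0) (hs : s ≠ 0) (ha : 0 < a)
    (hb0 : b ≠ 0) (hb1 : b ≠ 1) : 0 < s := by
  by_contra hns
  have hs' : s < 0 := lt_of_le_of_ne (not_lt.mp hns) hs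
  have has : a * s < 0 := mul_neg_of_pos_of_neg ha hs'
  have hE := f1_add_mul_f2 h1 h2
  have hW : b * (((d + 2) * a ^ 2 + 3) * s ^ 2 + a ^ 2)
      + a * s * ((d + 2) * (1 + b ^ 2 - a ^ 2) - 2 * (d + 4) * b) = 0 := by
    unfold f1 at h1
    linear_combination h1
  have hpos : 0 < ((d + 2) * a ^ 2 + 3) * s ^ 2 + a ^ 2 := by positivity
  have hdab : 0 < (d + 4) * a := by positivity
  have hcoef : 0 < s ^ 2 * ((d + 4) * a ^ 2 + 1) + a ^ 2 := by positivity
  rcases lt_or_gt_of_ne hb0 with hneg | hbpos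
  · have hWneg : (d + 2) * (1 + b ^ 2 - a ^ 2) - 2 * (d + 4) * b < 0 := by
      by_contra! hc
      linarith [mul_neg_of_neg_of_pos hneg hpos, mul_nonpos_of_nonpos_of_nonneg has.le hc]
    have hlarge : 1 + b ^ 2 < a ^ 2 := by
      by_contra! hc
      nlinarith [mul_nonneg (by linarith : 0 ≤ d + 2) (sub_nonneg.mpr hc),
        mul_pos (by linarith : 0 < d + 4) (neg_pos.mpr hneg)]
    have hD : 0 < b ^ 2 - 1 + a ^ 2 - 2 * (d + 4) * a * b := by
      nlinarith [mul_pos hdab (neg_pos.mpr hneg), sq_nonneg b]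
    linarith [mul_neg_of_neg_of_pos hneg hcoef, mul_neg_of_neg_of_pos has hD]
  · have hWpos : 0 < (d + 2) * (1 + b ^ 2 - a ^ 2) - 2 * (d + 4) * b := by
      by_contra! hc
      linarith [mul_pos hbpos hpos, mul_nonneg_of_nonpos_of_nonpos has.le hc]
    have hsmall : a ^ 2 < (b - 1) ^ 2 := by
      by_contra! hc
      nlinarith [mul_nonneg (by linarith : 0 ≤ d + 2) (sub_nonneg.mpr hc)]
    rcases lt_or_gt_of_ne hb1 with hlt | hgt
    · have hD : b ^ 2 - 1 + a ^ 2 - 2 * (d + 4) * a * b < 0 := by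
        nlinarith [mul_pos hdab hbpos, mul_pos hbpos (sub_pos.mpr hlt)]
      linarith [mul_pos hbpos hcoef, mul_pos_of_neg_of_neg has hD]
    · have hab : a < b - 1 := lt_of_pow_lt_pow_left₀ 2 (by linarith) hsmall
      have hDle : b ^ 2 - 1 + a ^ 2 - 2 * (d + 4) * a * b < -(a * b * s) := by
        unfold f3 at h3
        nlinarith [mul_pos hdab (by linarith : 0 < b + 1), mul_pos ha (sub_pos.mpr hab),
          mul_nonneg hd (mul_pos ha (by linarith : 0 < b + 1)).le]
      have hdom : a * s * -(a * b * s)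
          < a * s * (b ^ 2 - 1 + a ^ 2 - 2 * (d + 4) * a * b) :=
        mul_lt_mul_of_neg_left hDle has
      have hrest : 0 < b * s ^ 2 * ((d + 3) * a ^ 2 + 1) + b * a ^ 2 := by positivity
      linarith

/-- For every integer `n ≥ 6`, every real solution of `f1 = f2 = f3 = 0` with
`x2 · x12 · x13 · (x13 - 1) ≠ 0` satisfies `x12 > 0` and `x2 > 0`. -/
theorem stmt4 (n : ℕ) (hn : 6 ≤ n) (x2 x12 x13 : ℝ)
    (h1 : f1 n x2 x12 x13 = 0) (h2 : f2 n x2 x12 x13 = 0) (h3 : f3 n x2 x12 x13 = 0)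
    (hne : x2 * x12 * x13 * (x13 - 1) ≠ 0) :
    0 < x12 ∧ 0 < x2 := by
  have hd : (0 : ℝ) ≤ n - 6 := by
    have : (6 : ℝ) ≤ n := mod_cast hn
    linarith
  rw [← sub_add_cancel (n : ℝ) 6] at h1 h2 h3
  have hb1 : x13 ≠ 1 := sub_ne_zero.mp (right_ne_zero_of_mul hne)
  have hb0 : x13 ≠ 0 := right_ne_zero_of_mul (left_ne_zero_of_mul hne)
  have hsa : x2 * x12 ≠ 0 := left_ne_zero_of_mul (left_ne_zero_of_mul hne)
  have ha := x12_pos hd h1 h2 h3 (right_ne_zero_of_mul hsa) hb1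
  exact ⟨ha, x2_pos hd h1 h2 h3 (left_ne_zero_of_mul hsa) ha hb0 hb1⟩
end

section
/- For every integer n ≥ 9 there exist positive real numbers x2, x12 and a real number x13 with 1 − 2/n − 6/n² < x13 < 1 − 2/n − 7/(2n²) such that f1 = 0, f2 = 0 and f3 = 0. -/
open Set

/-- The resultant of `f2` and `f3` with respect to `x2`, up to a factor, in the variables
`e = 1/n`, `a = x12`, `b = x13`. -/
def resTwoThree (e a b : ℝ) : ℝ :=
  (4 * e - (1 - e) * a ^ 2) * b ^ 2 + 2 * (1 - 2 * e) * a * (a - 1) * b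
    + (a ^ 2 - 1) * ((1 - e) * a ^ 2 - 2 * (1 - 2 * e) * a + 4 * e)

/-- The numerator of the value of `x2` solving `f3 = 0`, divided by `n`. -/
def numTwo (e a b : ℝ) : ℝ :=
  (1 - 2 * e) * a * (b - 1) + e * (a ^ 2 + 2 * (1 - b ^ 2))

/-- The resultant of `f1` and `f3` with respect to `x2`, up to a factor. -/
def resOneThree (e a b : ℝ) : ℝ :=
  numTwo e a b ^ 2 * ((1 - 4 * e) * a ^ 2 + 3 * e)
    + numTwo e a b * e * a ^ 2 * ((1 - 4 * e) * (1 + b ^ 2 - a ^ 2) - 2 * (1 - 2 * e) * b)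
    + e ^ 3 * a ^ 4 * b ^ 2

/-- The left end of the range of `x12`. -/
noncomputable def aLeft (e : ℝ) : ℝ := 2 - 4 * e - 17 / 2 * e ^ 2 - 20 * e ^ 3 - 69 * e ^ 4

/-- The right end of the range of `x12`. -/
noncomputable def aRight (e : ℝ) : ℝ := 2 - 4 * e - 31 / 4 * e ^ 2 - 19 * e ^ 3 - 60 * e ^ 4

theorem exists_eq_inv_nine_add {e : ℝ} (he : 0 < e) (he' : e ≤ 1 / 9) :
    ∃ m : ℝ, 0 ≤ m ∧ e = 1 / (9 + m) := by
  refine ⟨1 / e - 9, ?_, ?_⟩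
  · have : 9 ≤ 1 / e := by rw [le_div_iff₀ he]; linarith
    linarith
  · field_simp
    ring

theorem exists_eq_inv_one_add {u : ℝ} (hu : 0 < u) (hu' : u ≤ 1) :
    ∃ v : ℝ, 0 ≤ v ∧ u = 1 / (1 + v) := by
  refine ⟨1 / u - 1, ?_, ?_⟩
  · have : 1 ≤ 1 / u := by rw [le_div_iff₀ hu]; linarith
    linarith
  · field_simp
    ring

theorem resTwoThree_aLeft_lower_pos {e : ℝ} (he : 0 < e) (he' : e ≤ 1 / 9) :
    0 < resTwoThree e (aLeft e) (1 - 2 * e - 6 * e ^ 2) := by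
  obtain ⟨m, hm, rfl⟩ := exists_eq_inv_nine_add he he'
  unfold resTwoThree aLeft
  field_simp
  ring_nf
  positivity

theorem resTwoThree_aRight_upper_neg {e : ℝ} (he : 0 < e) (he' : e ≤ 1 / 9) :
    resTwoThree e (aRight e) (1 - 2 * e - 7 / 2 * e ^ 2) < 0 := by
  obtain ⟨m, hm, rfl⟩ := exists_eq_inv_nine_add he he'
  rw [← neg_pos]
  unfold resTwoThree aRight
  field_simp
  ring_nf
  positivity

theorem resTwoThree_aRight_pos {e : ℝ} (he : 0 < e) (he' : e ≤ 1 / 9) :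
    0 < resTwoThree e (aRight e) (1 - 2 * e - 7 / 2 * e ^ 2 - 8 * e ^ 3) := by
  obtain ⟨m, hm, rfl⟩ := exists_eq_inv_nine_add he he'
  unfold resTwoThree aRight
  field_simp
  ring_nf
  positivity

theorem resTwoThree_aLeft_neg {e : ℝ} (he : 0 < e) (he' : e ≤ 1 / 9) :
    resTwoThree e (aLeft e) (1 - 2 * e - 4 * e ^ 2 - 69 / 4 * e ^ 3) < 0 := by
  obtain ⟨m, hm, rfl⟩ := exists_eq_inv_nine_add he he'
  rw [← neg_pos]
  unfold resTwoThree aLeft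
  field_simp
  ring_nf
  positivity

theorem resOneThree_aRight_neg {e b : ℝ} (he : 0 < e) (he' : e ≤ 1 / 9)
    (hb : 1 - 2 * e - 7 / 2 * e ^ 2 - 8 * e ^ 3 < b) (hb' : b ≤ 1 - 2 * e - 7 / 2 * e ^ 2) :
    resOneThree e (aRight e) b < 0 := by
  have hd : 0 < 8 * e ^ 3 := by positivity
  obtain ⟨v, hv, huv⟩ := exists_eq_inv_one_add
    (u := (b - (1 - 2 * e - 7 / 2 * e ^ 2 - 8 * e ^ 3)) / (8 * e ^ 3))
    (div_pos (by linarith) hd) (by rw [div_le_one hd]; linarith)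
  obtain rfl : b = 1 - 2 * e - 7 / 2 * e ^ 2 - 8 * e ^ 3 + 8 * e ^ 3 * (1 / (1 + v)) := by
    rw [← huv]
    field_simp
    ring
  clear huv hb hb' hd
  obtain ⟨m, hm, rfl⟩ := exists_eq_inv_nine_add he he'
  rw [← neg_pos]
  unfold resOneThree numTwo aRight
  field_simp
  ring_nf
  positivity

theorem resOneThree_aLeft_pos {e b : ℝ} (he : 0 < e) (he' : e ≤ 1 / 9)
    (hb : 1 - 2 * e - 6 * e ^ 2 ≤ b) (hb' : b < 1 - 2 * e - 4 * e ^ 2 - 69 / 4 * e ^ 3) :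
    0 < resOneThree e (aLeft e) b := by
  have hd : 0 < 2 * e ^ 2 - 69 / 4 * e ^ 3 := by nlinarith [pow_pos he 2]
  obtain ⟨v, hv, huv⟩ := exists_eq_inv_one_add
    (u := (1 - 2 * e - 4 * e ^ 2 - 69 / 4 * e ^ 3 - b) / (2 * e ^ 2 - 69 / 4 * e ^ 3))
    (div_pos (by linarith) hd) (by rw [div_le_one hd]; linarith)
  obtain rfl : b = 1 - 2 * e - 4 * e ^ 2 - 69 / 4 * e ^ 3
      - (2 * e ^ 2 - 69 / 4 * e ^ 3) * (1 / (1 + v)) := by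
    rw [← huv, mul_div_cancel₀ _ hd.ne']
    ring
  clear huv hb hb' hd
  obtain ⟨m, hm, rfl⟩ := exists_eq_inv_nine_add he he'
  unfold resOneThree numTwo aLeft
  field_simp
  ring_nf
  positivity

theorem aLeft_lt_aRight {e : ℝ} (he : 0 < e) : aLeft e < aRight e := by
  unfold aLeft aRight
  nlinarith [pow_pos he 2, pow_pos he 3, mul_pos (pow_pos he 3) he]

theorem lt_aLeft {e : ℝ} (he : 0 < e) (he' : e ≤ 1 / 9) : 2 - 27 / 5 * e < aLeft e := by
  obtain ⟨m, hm, rfl⟩ := exists_eq_inv_nine_add he he'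
  rw [← sub_pos]
  unfold aLeft
  field_simp
  ring_nf
  positivity

theorem resTwoThree_mono {e a a' b : ℝ} (he : 0 < e) (he' : e ≤ 1 / 9)
    (ha : 2 - 27 / 5 * e < a) (haa : a ≤ a')
    (hb : 1 - 2 * e - 6 * e ^ 2 ≤ b) (hb' : b ≤ 1) :
    resTwoThree e a b ≤ resTwoThree e a' b := by
  have h1 : 0 ≤ 2 / 3 * (1 - e) * (a + a') - 2 * (1 - 2 * e) := by nlinarith
  have h2 : 0 ≤ (5 * e - 1) + 2 * (1 - 2 * e) * b - (1 - e) * b ^ 2 := by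
    have h : 1 - b ≤ 8 / 3 * e := by nlinarith
    have : (1 - b) ^ 2 ≤ (8 / 3 * e) ^ 2 := pow_le_pow_left₀ (by linarith) h 2
    nlinarith
  have h0 : 0 < a := by linarith
  have h3 : 0 ≤ (1 - e) * (a + a') * (a - a') ^ 2 := by
    have : 0 ≤ 1 - e := by linarith
    have : 0 ≤ a + a' := by linarith
    positivity
  have h4 : 0 ≤ (1 - 2 * e) * (1 - b) := mul_nonneg (by linarith) (by linarith)
  have h5 := mul_nonneg (show 0 ≤ a ^ 2 + a * a' + a' ^ 2 by nlinarith) h1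
  have h6 := mul_nonneg (show 0 ≤ a + a' by linarith) h2
  have : resTwoThree e a' b - resTwoThree e a b = (a' - a) *
      ((a ^ 2 + a * a' + a' ^ 2) * (2 / 3 * (1 - e) * (a + a') - 2 * (1 - 2 * e))
        + 1 / 3 * ((1 - e) * (a + a') * (a - a') ^ 2)
        + (a + a') * ((5 * e - 1) + 2 * (1 - 2 * e) * b - (1 - e) * b ^ 2)
        + 2 * ((1 - 2 * e) * (1 - b))) := by
    unfold resTwoThree
    ring
  have := mul_nonneg (sub_nonneg.2 haa) (by linarith :
    0 ≤ (a ^ 2 + a * a' + a' ^ 2) * (2 / 3 * (1 - e) * (a + a') - 2 * (1 - 2 * e))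
        + 1 / 3 * ((1 - e) * (a + a') * (a - a') ^ 2)
        + (a + a') * ((5 * e - 1) + 2 * (1 - 2 * e) * b - (1 - e) * b ^ 2)
        + 2 * ((1 - 2 * e) * (1 - b)))
  linarith

/-- The larger root of `A * x ^ 2 - 2 * B * x - C`. -/
noncomputable def largerRoot (A B C : ℝ) : ℝ := (B + √(B ^ 2 + A * C)) / A

section LargerRoot

variable {A B C x y : ℝ}

theorem discrim_pos (hA : 0 < A) (hx : A * x ^ 2 - 2 * B * x - C < 0) :
    0 < B ^ 2 + A * C := by
  nlinarith [sq_nonneg (A * x - B), mul_pos_of_neg_of_neg hx (neg_lt_zero.2 hA)]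

theorem largerRoot_eq (hA : 0 < A) (hx : A * x ^ 2 - 2 * B * x - C < 0) :
    A * largerRoot A B C ^ 2 - 2 * B * largerRoot A B C - C = 0 := by
  have h := Real.sq_sqrt (discrim_pos hA hx).le
  unfold largerRoot
  field_simp
  linear_combination h

theorem lt_largerRoot (hA : 0 < A) (hx : A * x ^ 2 - 2 * B * x - C < 0) :
    x < largerRoot A B C := by
  unfold largerRoot
  rw [lt_div_iff₀ hA, ← sub_lt_iff_lt_add']
  apply Real.lt_sqrt_of_sq_lt
  nlinarith [mul_pos_of_neg_of_neg hx (neg_lt_zero.2 hA)]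

theorem largerRoot_lt (hA : 0 < A) (hxy : x < y) (hx : A * x ^ 2 - 2 * B * x - C < 0)
    (hy : 0 < A * y ^ 2 - 2 * B * y - C) : largerRoot A B C < y := by
  have hr := largerRoot_eq hA hx
  have hlt := lt_largerRoot hA hx
  by_contra! h
  set r := largerRoot A B C
  have h1 : 0 < A * (r + x) - 2 * B := by
    have : 0 < (r - x) * (A * (r + x) - 2 * B) := by linarith
    exact (pos_iff_pos_of_mul_pos this).1 (sub_pos.2 hlt)
  nlinarith [mul_nonneg (sub_nonneg.2 h) (show 0 ≤ A * (r + y) - 2 * B by nlinarith)]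

end LargerRoot

/-- The larger solution `b` of `resTwoThree e a b = 0`. -/
noncomputable def bRoot (e a : ℝ) : ℝ :=
  largerRoot ((1 - e) * a ^ 2 - 4 * e) ((1 - 2 * e) * a * (a - 1))
    ((a ^ 2 - 1) * ((1 - e) * a ^ 2 - 2 * (1 - 2 * e) * a + 4 * e))

theorem neg_resTwoThree (e a b : ℝ) :
    ((1 - e) * a ^ 2 - 4 * e) * b ^ 2 - 2 * ((1 - 2 * e) * a * (a - 1)) * b
      - (a ^ 2 - 1) * ((1 - e) * a ^ 2 - 2 * (1 - 2 * e) * a + 4 * e) = -resTwoThree e a b := by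
  unfold resTwoThree
  ring

theorem leading_pos {e a : ℝ} (he : 0 < e) (he' : e ≤ 1 / 9) (ha : 2 - 27 / 5 * e < a) :
    0 < (1 - e) * a ^ 2 - 4 * e := by
  have : 7 / 5 ≤ a := by linarith
  nlinarith [mul_nonneg (show 0 ≤ 1 - e by linarith) (show 0 ≤ a ^ 2 - 49 / 25 by nlinarith)]

theorem resTwoThree_bRoot {e a x : ℝ} (hA : 0 < (1 - e) * a ^ 2 - 4 * e)
    (hx : 0 < resTwoThree e a x) : resTwoThree e a (bRoot e a) = 0 := by
  rw [← neg_eq_zero, ← neg_resTwoThree]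
  exact largerRoot_eq hA (x := x) (by rw [neg_resTwoThree]; linarith)

theorem lt_bRoot {e a x : ℝ} (hA : 0 < (1 - e) * a ^ 2 - 4 * e)
    (hx : 0 < resTwoThree e a x) : x < bRoot e a :=
  lt_largerRoot hA (by rw [neg_resTwoThree]; linarith)

theorem bRoot_lt {e a x y : ℝ} (hA : 0 < (1 - e) * a ^ 2 - 4 * e) (hxy : x < y)
    (hx : 0 < resTwoThree e a x) (hy : resTwoThree e a y < 0) : bRoot e a < y :=
  largerRoot_lt hA hxy (by rw [neg_resTwoThree]; linarith) (by rw [neg_resTwoThree]; linarith)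

theorem exists_common_zero {e : ℝ} (he : 0 < e) (he' : e ≤ 1 / 9) :
    ∃ a b : ℝ, 2 - 27 / 5 * e < a ∧ 1 - 2 * e - 6 * e ^ 2 < b ∧ b < 1 - 2 * e - 7 / 2 * e ^ 2 ∧
      resTwoThree e a b = 0 ∧ resOneThree e a b = 0 := by
  have he2 := pow_pos he 2
  have hlt := aLeft_lt_aRight he
  have hgt : ∀ a ∈ Icc (aLeft e) (aRight e), 2 - 27 / 5 * e < a := fun a ha =>
    (lt_aLeft he he').trans_le ha.1
  have hA : ∀ a ∈ Icc (aLeft e) (aRight e), 0 < (1 - e) * a ^ 2 - 4 * e := fun a ha =>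
    leading_pos he he' (hgt a ha)
  have hlow : ∀ a ∈ Icc (aLeft e) (aRight e), 0 < resTwoThree e a (1 - 2 * e - 6 * e ^ 2) :=
    fun a ha => (resTwoThree_aLeft_lower_pos he he').trans_le <|
      resTwoThree_mono he he' (lt_aLeft he he') ha.1 le_rfl (by linarith)
  have hupp : ∀ a ∈ Icc (aLeft e) (aRight e), resTwoThree e a (1 - 2 * e - 7 / 2 * e ^ 2) < 0 :=
    fun a ha => (resTwoThree_mono he he' (hgt a ha) ha.2 (by linarith) (by linarith)).trans_lt
      (resTwoThree_aRight_upper_neg he he')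
  have hb : ∀ a ∈ Icc (aLeft e) (aRight e), bRoot e a < 1 - 2 * e - 7 / 2 * e ^ 2 :=
    fun a ha => bRoot_lt (hA a ha) (by linarith) (hlow a ha) (hupp a ha)
  have hb' : ∀ a ∈ Icc (aLeft e) (aRight e), 1 - 2 * e - 6 * e ^ 2 < bRoot e a :=
    fun a ha => lt_bRoot (hA a ha) (hlow a ha)
  have hcont : ContinuousOn (fun a => resOneThree e a (bRoot e a))
      (Icc (aLeft e) (aRight e)) := by
    have : ContinuousOn (bRoot e) (Icc (aLeft e) (aRight e)) := by
      unfold bRoot largerRoot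
      exact ContinuousOn.div (by fun_prop) (by fun_prop) fun a ha => (hA a ha).ne'
    unfold resOneThree numTwo
    fun_prop
  have hl := left_mem_Icc.2 hlt.le
  have hr := right_mem_Icc.2 hlt.le
  have hleft : 0 < resOneThree e (aLeft e) (bRoot e (aLeft e)) :=
    resOneThree_aLeft_pos he he' (hb' _ hl).le <|
      bRoot_lt (hA _ hl) (by nlinarith) (hlow _ hl) (resTwoThree_aLeft_neg he he')
  have hright : resOneThree e (aRight e) (bRoot e (aRight e)) < 0 :=
    resOneThree_aRight_neg he he' (lt_bRoot (hA _ hr) (resTwoThree_aRight_pos he he'))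
      (hb _ hr).le
  obtain ⟨a, ha, h⟩ := intermediate_value_Icc' hlt.le hcont ⟨hright.le, hleft.le⟩
  exact ⟨a, bRoot e a, hgt a ha, hb' a ha, hb a ha, resTwoThree_bRoot (hA a ha) (hlow a ha), h⟩

theorem numTwo_pos {e a b : ℝ} (he : 0 < e) (he' : e ≤ 1 / 9) (ha : 7 / 5 ≤ a)
    (hb : 1 / 2 ≤ b) (hb' : b ≤ 1) (h : resOneThree e a b = 0) : 0 < numTwo e a b := by
  have hneg : (1 - 4 * e) * (1 + b ^ 2 - a ^ 2) - 2 * (1 - 2 * e) * b < 0 := by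
    have : 1 + b ^ 2 - a ^ 2 ≤ 1 / 25 := by nlinarith
    nlinarith [mul_le_mul_of_nonneg_left this (show 0 ≤ 1 - 4 * e by linarith)]
  have ha0 : 0 < a := by linarith
  have hb0 : 0 < b := by linarith
  by_contra! hP
  have h1 : 0 ≤ numTwo e a b ^ 2 * ((1 - 4 * e) * a ^ 2 + 3 * e) := by
    have : 0 ≤ 1 - 4 * e := by linarith
    positivity
  have h2 := mul_nonneg_of_nonpos_of_nonpos
    (mul_nonpos_of_nonpos_of_nonneg hP (show 0 ≤ e * a ^ 2 by positivity)) hneg.le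
  have h3 : 0 < e ^ 3 * a ^ 4 * b ^ 2 := by positivity
  unfold resOneThree at h
  linarith

/-- For every integer `n ≥ 9` there is a solution of `f1 = f2 = f3 = 0` with
`x2, x12 > 0` and `1 - 2/n - 6/n² < x13 < 1 - 2/n - 7/(2n²)`. -/
theorem stmt13 (n : ℕ) (hn : 9 ≤ n) :
    ∃ x2 x12 x13 : ℝ, 0 < x2 ∧ 0 < x12 ∧
      1 - 2 / (n : ℝ) - 6 / (n : ℝ) ^ 2 < x13 ∧ x13 < 1 - 2 / (n : ℝ) - 7 / (2 * (n : ℝ) ^ 2) ∧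
      f1 n x2 x12 x13 = 0 ∧ f2 n x2 x12 x13 = 0 ∧ f3 n x2 x12 x13 = 0 := by
  have hn' : (9 : ℝ) ≤ n := by exact_mod_cast hn
  have hn0 : (0 : ℝ) < n := by linarith
  have he : 0 < 1 / (n : ℝ) := by positivity
  have he' : 1 / (n : ℝ) ≤ 1 / 9 := one_div_le_one_div_of_le (by norm_num) hn'
  obtain ⟨a, b, ha, hb, hb', h23, h13⟩ := exists_common_zero he he'
  have ha' : 7 / 5 ≤ a := by linarith
  have ha0 : 0 < a := by linarith
  have hbhalf : 1 / 2 ≤ b := by nlinarith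
  have hb0 : 0 < b := by linarith
  have hP := numTwo_pos he he' ha' hbhalf (by nlinarith) h13
  refine ⟨n * numTwo (1 / n) a b / (a * b), a, b, by positivity, ha0, ?_, ?_, ?_, ?_, ?_⟩
  · convert hb using 1
    field_simp
  · convert hb' using 1
    field_simp
  · have : f1 n (n * numTwo (1 / n) a b / (a * b)) a b
        = n ^ 3 / (a ^ 2 * b) * resOneThree (1 / n) a b := by
      unfold f1 resOneThree
      generalize hp : numTwo (1 / n) a b = p
      field_simp
      ring
    rw [this, h13, mul_zero]
  · have : f2 n (n * numTwo (1 / n) a b / (a * b)) a b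
        = n / a * resTwoThree (1 / n) a b := by
      unfold f2 resTwoThree numTwo
      field_simp
      ring
    rw [this, h23, mul_zero]
  · unfold f3 numTwo
    field_simp
    ring
end

section
/- There exist real numbers x1, x2, x12, x13 with 0.82 < x1 < 0.84, 0.14 < x2 < 0.16, 0.61 < x12 < 0.63 and 1.13 < x13 < 1.15 satisfying g1 = 0, g2 = 0, g3 = 0 and g4 = 0; in particular the system has a solution in positive reals with x13 ≠ 1. -/
/-- `g1` from the Einstein equations for `V₅ℝ⁷ = SO(7)/SO(2)`
(Ad(SO(2)×SO(3)×SO(2))-invariant metrics, normalization `x23 = 1`). -/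
def g1 (x1 x2 x12 x13 : ℝ) : ℝ :=
  2 * x1 * x12 ^ 2 * x2 + 3 * x1 * x13 ^ 2 * x2 - 2 * x12 ^ 2 * x13 ^ 2 * x2 ^ 2
    - x12 ^ 2 * x13 ^ 2 - 2 * x13 ^ 2 * x2 ^ 2

/-- `g2` from the Einstein equations for `V₅ℝ⁷`. -/
def g2 (x1 x2 x12 x13 : ℝ) : ℝ :=
  x1 * x13 * x2 - 2 * x12 ^ 3 * x2 + 2 * x12 ^ 2 * x13 * x2 ^ 2 + x12 ^ 2 * x13
    + 2 * x12 * x13 ^ 2 * x2 - 10 * x12 * x13 * x2 + 2 * x12 * x2 + 4 * x13 * x2 ^ 2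

/-- `g3` from the Einstein equations for `V₅ℝ⁷`. -/
def g3 (x1 x2 x12 x13 : ℝ) : ℝ :=
  -x1 * x13 + 4 * x12 ^ 3 + 2 * x12 ^ 2 * x13 * x2 - 10 * x12 ^ 2 * x13
    + 10 * x12 * x13 - 4 * x12 - 2 * x13 * x2

/-- `g4` from the Einstein equations for `V₅ℝ⁷`. -/
def g4 (x1 x2 x12 x13 : ℝ) : ℝ :=
  x1 * x12 + x12 ^ 2 * x13 - 2 * x12 * x13 ^ 2 * x2 + 10 * x12 * x13 ^ 2
    - 10 * x12 * x13 - 5 * x13 ^ 3 + 5 * x13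


section IntervalArithmetic

open Set

variable {x y a b c d : ℝ}

lemma add_mem_Icc_add (hx : x ∈ Icc a b) (hy : y ∈ Icc c d) : x + y ∈ Icc (a + c) (b + d) :=
  ⟨add_le_add hx.1 hy.1, add_le_add hx.2 hy.2⟩

lemma sub_mem_Icc_sub (hx : x ∈ Icc a b) (hy : y ∈ Icc c d) : x - y ∈ Icc (a - d) (b - c) :=
  ⟨sub_le_sub hx.1 hy.2, sub_le_sub hx.2 hy.1⟩

lemma neg_mem_Icc_neg (hx : x ∈ Icc a b) : -x ∈ Icc (-b) (-a) :=
  ⟨neg_le_neg hx.2, neg_le_neg hx.1⟩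

lemma mul_mem_Icc_mul (hx : x ∈ Icc a b) (hy : y ∈ Icc c d) (ha : 0 ≤ a) (hc : 0 ≤ c) :
    x * y ∈ Icc (a * c) (b * d) :=
  ⟨mul_le_mul hx.1 hy.1 hc (ha.trans hx.1),
    mul_le_mul hx.2 hy.2 (hc.trans hy.1) (ha.trans (hx.1.trans hx.2))⟩

lemma pow_mem_Icc_pow (n : ℕ) (hx : x ∈ Icc a b) (ha : 0 ≤ a) : x ^ n ∈ Icc (a ^ n) (b ^ n) :=
  ⟨pow_le_pow_left₀ ha hx.1 n, pow_le_pow_left₀ (ha.trans hx.1) hx.2 n⟩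

lemma self_mem_Icc (a : ℝ) : a ∈ Icc a a :=
  left_mem_Icc.2 le_rfl

lemma abs_sub_le_of_mem_Icc (hx : x ∈ Icc a b) (ha : c - d ≤ a) (hb : b ≤ c + d) :
    |x - c| ≤ d :=
  abs_sub_le_iff.2 ⟨by linarith [hx.2], by linarith [hx.1]⟩

end IntervalArithmetic

lemma abs_mul_add_four_le {e₁ e₂ e₃ e₄ d₁ d₂ d₃ d₄ δ m : ℝ}
    (he : |e₁| ≤ δ ∧ |e₂| ≤ δ ∧ |e₃| ≤ δ ∧ |e₄| ≤ δ)
    (hd : |d₁| ≤ m ∧ |d₂| ≤ m ∧ |d₃| ≤ m ∧ |d₄| ≤ m) :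
    |e₁ * d₁ + e₂ * d₂ + e₃ * d₃ + e₄ * d₄| ≤ 4 * δ * m := by
  have key {e d : ℝ} (he : |e| ≤ δ) (hd : |d| ≤ m) : |e * d| ≤ δ * m := by
    rw [abs_mul]
    exact mul_le_mul he hd (abs_nonneg d) ((abs_nonneg e).trans he)
  obtain ⟨he₁, he₂, he₃, he₄⟩ := he
  obtain ⟨hd₁, hd₂, hd₃, hd₄⟩ := hd
  have h₁ := abs_le.1 (key he₁ hd₁)
  have h₂ := abs_le.1 (key he₂ hd₂)
  have h₃ := abs_le.1 (key he₃ hd₃)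
  have h₄ := abs_le.1 (key he₄ hd₄)
  exact abs_le.2 ⟨by linarith [h₁.1, h₂.1, h₃.1, h₄.1], by linarith [h₁.2, h₂.2, h₃.2, h₄.2]⟩

/-- A map which differs from the identity by a contraction on a closed ball, and whose value at
the centre is small, vanishes somewhere on the ball. -/
lemma exists_mem_closedBall_eq_zero {E : Type*} [NormedAddCommGroup E]
    [CompleteSpace E] {f : E → E} {b : E} {r : ℝ} {c : NNReal} (hr : 0 ≤ r) (hc : c < 1)
    (hf : ∀ x ∈ Metric.closedBall b r, ∀ y ∈ Metric.closedBall b r,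
      ‖f x - f y - (x - y)‖ ≤ c * ‖x - y‖)
    (hb : ‖f b‖ ≤ (1 - c) * r) : ∃ x ∈ Metric.closedBall b r, f x = 0 := by
  have hmaps : Set.MapsTo (fun x ↦ x - f x) (Metric.closedBall b r) (Metric.closedBall b r) := by
    intro x hx
    have h := hf x hx b (Metric.mem_closedBall_self hr)
    rw [mem_closedBall_iff_norm] at hx ⊢
    calc ‖x - f x - b‖ = ‖-(f x - f b - (x - b)) - f b‖ := by congr 1; abel
      _ ≤ ‖f x - f b - (x - b)‖ + ‖f b‖ := (norm_sub_le _ _).trans_eq (by rw [norm_neg])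
      _ ≤ c * r + (1 - c) * r := by gcongr; exact h.trans (by gcongr)
      _ = r := by ring
  have hcontr : ContractingWith c (hmaps.restrict _ _ _) := by
    refine ⟨hc, LipschitzWith.of_dist_le_mul fun x y ↦ ?_⟩
    calc dist ((x : E) - f x) (y - f y) = ‖f x - f y - ((x : E) - y)‖ := by
          rw [dist_comm, dist_eq_norm]
          congr 1
          abel
      _ ≤ c * dist (x : E) y := dist_eq_norm (x : E) y ▸ hf x x.2 y y.2
  obtain ⟨x, hx, hfix, -⟩ := hcontr.exists_fixedPoint' Metric.isClosed_closedBall.isComplete hmaps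
    (Metric.mem_closedBall_self hr) (edist_ne_top _ _)
  exact ⟨x, hx, by simpa [Function.IsFixedPt] using hfix⟩

lemma pi_norm_fin_four_le_iff {x : Fin 4 → ℝ} {r : ℝ} (hr : 0 ≤ r) :
    ‖x‖ ≤ r ↔ |x 0| ≤ r ∧ |x 1| ≤ r ∧ |x 2| ≤ r ∧ |x 3| ≤ r := by
  rw [pi_norm_le_iff_of_nonneg hr]
  refine ⟨fun h ↦ ⟨h 0, h 1, h 2, h 3⟩, fun ⟨h0, h1, h2, h3⟩ i ↦ ?_⟩
  fin_cases i <;> assumption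

/-- A cube of radius `1 / 1000` around an approximate solution, in the order `x1`, `x2`, `x12`,
`x13`. -/
def solutionBox : Set (ℝ × ℝ × ℝ × ℝ) :=
  Set.Icc 0.8308 0.8328 ×ˢ Set.Icc 0.1484 0.1504 ×ˢ Set.Icc 0.6192 0.6212 ×ˢ Set.Icc 1.1383 1.1403

section Linearization

variable {x1 x2 x12 x13 y1 y2 y12 y13 m : ℝ}

lemma abs_g1_sub_sub_le (hx : (x1, x2, x12, x13) ∈ solutionBox)
    (hy : (y1, y2, y12, y13) ∈ solutionBox)
    (hd : |x1 - y1| ≤ m ∧ |x2 - y2| ≤ m ∧ |x12 - y12| ≤ m ∧ |x13 - y13| ≤ m) :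
    |g1 x1 x2 x12 x13 - g1 y1 y2 y12 y13 -
      (0.7 * (x1 - y1) + 2.8 * (x2 - y2) - 1.37 * (x12 - y12) - 0.17 * (x13 - y13))| ≤
      2 / 5 * m := by
  obtain ⟨hx1, hx2, hx12, hx13⟩ := hx
  obtain ⟨hy1, hy2, hy12, hy13⟩ := hy
  dsimp only at hx1 hx2 hx12 hx13 hy1 hy2 hy12 hy13
  have he :
      |2 * y2 * y12 ^ 2 + 3 * y2 * y13 ^ 2 - 0.7| ≤ 1 / 10 ∧
      |2 * x1 * y12 ^ 2 + 3 * x1 * y13 ^ 2 - (2 * x2 * y12 ^ 2 * y13 ^ 2 + 2 * y2 * y12 ^ 2 * y13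
        ^ 2 + 2 * x2 * y13 ^ 2 + 2 * y2 * y13 ^ 2) - 2.8| ≤ 1 / 10 ∧
      |2 * x1 * x2 * x12 + 2 * x1 * x2 * y12 - (2 * x2 ^ 2 * x12 * y13 ^ 2 + 2 * x2 ^ 2 * y12 *
        y13 ^ 2 + x12 * y13 ^ 2 + y12 * y13 ^ 2) - (-1.37)| ≤ 1 / 10 ∧
      |3 * x1 * x2 * x13 + 3 * x1 * x2 * y13 - (2 * x2 ^ 2 * x12 ^ 2 * x13 + 2 * x2 ^ 2 * x12 ^ 2
        * y13 + x12 ^ 2 * x13 + x12 ^ 2 * y13 + 2 * x2 ^ 2 * x13 + 2 * x2 ^ 2 * y13) - (-0.17)| ≤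
        1 / 10 := by
    refine ⟨?_, ?_, ?_, ?_⟩
    all_goals
      apply abs_sub_le_of_mem_Icc
      repeat' with_reducible first
        | assumption
        | apply add_mem_Icc_add
        | apply sub_mem_Icc_sub
        | apply neg_mem_Icc_neg
        | apply mul_mem_Icc_mul
        | apply pow_mem_Icc_pow
        | apply self_mem_Icc
    all_goals norm_num
  convert abs_mul_add_four_le he hd using 1
  · unfold g1
    ring_nf
  · ring

lemma abs_g2_sub_sub_le (hx : (x1, x2, x12, x13) ∈ solutionBox)
    (hy : (y1, y2, y12, y13) ∈ solutionBox)
    (hd : |x1 - y1| ≤ m ∧ |x2 - y2| ≤ m ∧ |x12 - y12| ≤ m ∧ |x13 - y13| ≤ m) :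
    |g2 x1 x2 x12 x13 - g2 y1 y2 y12 y13 -
      (0.17 * (x1 - y1) - 2.12 * (x2 - y2) + 0.12 * (x12 - y12) + 0.11 * (x13 - y13))| ≤
      2 / 5 * m := by
  obtain ⟨hx1, hx2, hx12, hx13⟩ := hx
  obtain ⟨hy1, hy2, hy12, hy13⟩ := hy
  dsimp only at hx1 hx2 hx12 hx13 hy1 hy2 hy12 hy13
  have he :
      |y2 * y13 - 0.17| ≤ 1 / 10 ∧
      |x1 * y13 + 2 * x2 * y12 ^ 2 * y13 + 2 * y2 * y12 ^ 2 * y13 + 2 * y12 * y13 ^ 2 + 2 * y12 +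
        4 * x2 * y13 + 4 * y2 * y13 - (2 * y12 ^ 3 + 10 * y12 * y13) - (-2.12)| ≤ 1 / 10 ∧
      |2 * x2 ^ 2 * x12 * y13 + 2 * x2 ^ 2 * y12 * y13 + x12 * y13 + y12 * y13 + 2 * x2 * y13 ^ 2
        + 2 * x2 - (2 * x2 * x12 ^ 2 + 2 * x2 * x12 * y12 + 2 * x2 * y12 ^ 2 + 10 * x2 * y13) -
        0.12| ≤ 1 / 10 ∧
      |x1 * x2 + 2 * x2 ^ 2 * x12 ^ 2 + x12 ^ 2 + 2 * x2 * x12 * x13 + 2 * x2 * x12 * y13 + 4 * x2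
        ^ 2 - 10 * x2 * x12 - 0.11| ≤ 1 / 10 := by
    refine ⟨?_, ?_, ?_, ?_⟩
    all_goals
      apply abs_sub_le_of_mem_Icc
      repeat' with_reducible first
        | assumption
        | apply add_mem_Icc_add
        | apply sub_mem_Icc_sub
        | apply neg_mem_Icc_neg
        | apply mul_mem_Icc_mul
        | apply pow_mem_Icc_pow
        | apply self_mem_Icc
    all_goals norm_num
  convert abs_mul_add_four_le he hd using 1
  · unfold g2
    ring_nf
  · ring

lemma abs_g3_sub_sub_le (hx : (x1, x2, x12, x13) ∈ solutionBox)
    (hy : (y1, y2, y12, y13) ∈ solutionBox)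
    (hd : |x1 - y1| ≤ m ∧ |x2 - y2| ≤ m ∧ |x12 - y12| ≤ m ∧ |x13 - y13| ≤ m) :
    |g3 x1 x2 x12 x13 - g3 y1 y2 y12 y13 -
      (-1.14 * (x1 - y1) - 1.4 * (x2 - y2) - 1.7 * (x12 - y12) + 1.34 * (x13 - y13))| ≤
      2 / 5 * m := by
  obtain ⟨hx1, hx2, hx12, hx13⟩ := hx
  obtain ⟨hy1, hy2, hy12, hy13⟩ := hy
  dsimp only at hx1 hx2 hx12 hx13 hy1 hy2 hy12 hy13
  have he :
      |-(y13) - (-1.14)| ≤ 1 / 10 ∧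
      |2 * y12 ^ 2 * y13 - 2 * y13 - (-1.4)| ≤ 1 / 10 ∧
      |4 * x12 ^ 2 + 4 * x12 * y12 + 4 * y12 ^ 2 + 2 * x2 * x12 * y13 + 2 * x2 * y12 * y13 + 10 *
        y13 - (10 * x12 * y13 + 10 * y12 * y13 + 4) - (-1.7)| ≤ 1 / 10 ∧
      |2 * x2 * x12 ^ 2 + 10 * x12 - (x1 + 10 * x12 ^ 2 + 2 * x2) - 1.34| ≤ 1 / 10 := by
    refine ⟨?_, ?_, ?_, ?_⟩
    all_goals
      apply abs_sub_le_of_mem_Icc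
      repeat' with_reducible first
        | assumption
        | apply add_mem_Icc_add
        | apply sub_mem_Icc_sub
        | apply neg_mem_Icc_neg
        | apply mul_mem_Icc_mul
        | apply pow_mem_Icc_pow
        | apply self_mem_Icc
    all_goals norm_num
  convert abs_mul_add_four_le he hd using 1
  · unfold g3
    ring_nf
  · ring

lemma abs_g4_sub_sub_le (hx : (x1, x2, x12, x13) ∈ solutionBox)
    (hy : (y1, y2, y12, y13) ∈ solutionBox)
    (hd : |x1 - y1| ≤ m ∧ |x2 - y2| ≤ m ∧ |x12 - y12| ≤ m ∧ |x13 - y13| ≤ m) :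
    |g4 x1 x2 x12 x13 - g4 y1 y2 y12 y13 -
      (0.62 * (x1 - y1) - 1.61 * (x2 - y2) + 3.44 * (x12 - y12) - 6.58 * (x13 - y13))| ≤
      2 / 5 * m := by
  obtain ⟨hx1, hx2, hx12, hx13⟩ := hx
  obtain ⟨hy1, hy2, hy12, hy13⟩ := hy
  dsimp only at hx1 hx2 hx12 hx13 hy1 hy2 hy12 hy13
  have he :
      |y12 - 0.62| ≤ 1 / 10 ∧
      |-(2 * y12 * y13 ^ 2) - (-1.61)| ≤ 1 / 10 ∧
      |x1 + x12 * y13 + y12 * y13 + 10 * y13 ^ 2 - (2 * x2 * y13 ^ 2 + 10 * y13) - 3.44| ≤ 1 / 10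
        ∧
      |x12 ^ 2 + 10 * x12 * x13 + 10 * x12 * y13 + 5 - (2 * x2 * x12 * x13 + 2 * x2 * x12 * y13 +
        10 * x12 + 5 * x13 ^ 2 + 5 * x13 * y13 + 5 * y13 ^ 2) - (-6.58)| ≤ 1 / 10 := by
    refine ⟨?_, ?_, ?_, ?_⟩
    all_goals
      apply abs_sub_le_of_mem_Icc
      repeat' with_reducible first
        | assumption
        | apply add_mem_Icc_add
        | apply sub_mem_Icc_sub
        | apply neg_mem_Icc_neg
        | apply mul_mem_Icc_mul
        | apply pow_mem_Icc_pow
        | apply self_mem_Icc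
    all_goals norm_num
  convert abs_mul_add_four_le he hd using 1
  · unfold g4
    ring_nf
  · ring

end Linearization

/-- The system `g1, g2, g3, g4` multiplied by an approximate inverse of its Jacobian matrix. -/
def preconditioned (x : Fin 4 → ℝ) : Fin 4 → ℝ :=
  ![0.46 * g1 (x 0) (x 1) (x 2) (x 3) + 1.01 * g2 (x 0) (x 1) (x 2) (x 3) -
      0.497 * g3 (x 0) (x 1) (x 2) (x 3) - 0.096 * g4 (x 0) (x 1) (x 2) (x 3),
    0.001 * g1 (x 0) (x 1) (x 2) (x 3) - 0.406 * g2 (x 0) (x 1) (x 2) (x 3) -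
      0.072 * g3 (x 0) (x 1) (x 2) (x 3) - 0.022 * g4 (x 0) (x 1) (x 2) (x 3),
    -0.468 * g1 (x 0) (x 1) (x 2) (x 3) - 0.321 * g2 (x 0) (x 1) (x 2) (x 3) -
      0.372 * g3 (x 0) (x 1) (x 2) (x 3) - 0.069 * g4 (x 0) (x 1) (x 2) (x 3),
    -0.202 * g1 (x 0) (x 1) (x 2) (x 3) + 0.027 * g2 (x 0) (x 1) (x 2) (x 3) -
      0.224 * g3 (x 0) (x 1) (x 2) (x 3) - 0.192 * g4 (x 0) (x 1) (x 2) (x 3)]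

lemma mem_solutionBox_of_mem_closedBall {x : Fin 4 → ℝ}
    (hx : x ∈ Metric.closedBall ![0.8318, 0.1494, 0.6202, 1.1393] (1 / 1000)) :
    (x 0, x 1, x 2, x 3) ∈ solutionBox := by
  rw [mem_closedBall_iff_norm, pi_norm_fin_four_le_iff (by norm_num)] at hx
  simp only [Pi.sub_apply, Matrix.cons_val, abs_le] at hx
  obtain ⟨h0, h1, h2, h3⟩ := hx
  refine ⟨⟨?_, ?_⟩, ⟨?_, ?_⟩, ⟨?_, ?_⟩, ⟨?_, ?_⟩⟩
  all_goals
    norm_num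
    linarith

lemma norm_preconditioned_sub_sub_le {x y : Fin 4 → ℝ}
    (hx : (x 0, x 1, x 2, x 3) ∈ solutionBox) (hy : (y 0, y 1, y 2, y 3) ∈ solutionBox) :
    ‖preconditioned x - preconditioned y - (x - y)‖ ≤ 9 / 10 * ‖x - y‖ := by
  have hd := (pi_norm_fin_four_le_iff (norm_nonneg (x - y))).1 le_rfl
  simp only [Pi.sub_apply] at hd
  have h1 := abs_le.1 (abs_g1_sub_sub_le hx hy hd)
  have h2 := abs_le.1 (abs_g2_sub_sub_le hx hy hd)
  have h3 := abs_le.1 (abs_g3_sub_sub_le hx hy hd)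
  have h4 := abs_le.1 (abs_g4_sub_sub_le hx hy hd)
  simp only [abs_le] at hd
  rw [pi_norm_fin_four_le_iff (by positivity)]
  simp only [Pi.sub_apply, Matrix.cons_val, abs_le, preconditioned]
  refine ⟨⟨?_, ?_⟩, ⟨?_, ?_⟩, ⟨?_, ?_⟩, ⟨?_, ?_⟩⟩ <;> linarith

lemma norm_preconditioned_center_le :
    ‖preconditioned ![0.8318, 0.1494, 0.6202, 1.1393]‖ ≤ 1 / 10000 := by
  rw [pi_norm_fin_four_le_iff (by norm_num)]
  simp only [Matrix.cons_val, abs_le, preconditioned, g1, g2, g3, g4]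
  norm_num

lemma eq_zero_of_preconditioned_eq_zero {x : Fin 4 → ℝ} (h : preconditioned x = 0) :
    g1 (x 0) (x 1) (x 2) (x 3) = 0 ∧ g2 (x 0) (x 1) (x 2) (x 3) = 0 ∧
      g3 (x 0) (x 1) (x 2) (x 3) = 0 ∧ g4 (x 0) (x 1) (x 2) (x 3) = 0 := by
  have h0 := congr_fun h 0
  have h1 := congr_fun h 1
  have h2 := congr_fun h 2
  have h3 := congr_fun h 3
  simp only [preconditioned, Matrix.cons_val, Pi.zero_apply] at h0 h1 h2 h3
  refine ⟨?_, ?_, ?_, ?_⟩ <;> linarith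

/-- The system `g1 = g2 = g3 = g4 = 0` has a solution with `0.82 < x1 < 0.84`,
`0.14 < x2 < 0.16`, `0.61 < x12 < 0.63` and `1.13 < x13 < 1.15`; in particular a positive
solution with `x13 ≠ 1`. -/
theorem stmt16 :
    ∃ x1 x2 x12 x13 : ℝ,
      0.82 < x1 ∧ x1 < 0.84 ∧ 0.14 < x2 ∧ x2 < 0.16 ∧
      0.61 < x12 ∧ x12 < 0.63 ∧ 1.13 < x13 ∧ x13 < 1.15 ∧
      g1 x1 x2 x12 x13 = 0 ∧ g2 x1 x2 x12 x13 = 0 ∧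
      g3 x1 x2 x12 x13 = 0 ∧ g4 x1 x2 x12 x13 = 0 := by
  obtain ⟨x, hx, h⟩ := exists_mem_closedBall_eq_zero (f := preconditioned)
    (b := ![0.8318, 0.1494, 0.6202, 1.1393]) (r := 1 / 1000) (c := 9 / 10)
    (by norm_num) (by rw [← NNReal.coe_lt_coe]; norm_num)
    (fun x hx y hy ↦ by
      simpa using norm_preconditioned_sub_sub_le (mem_solutionBox_of_mem_closedBall hx)
        (mem_solutionBox_of_mem_closedBall hy))
    (norm_preconditioned_center_le.trans (by norm_num))
  obtain ⟨⟨h1, h1'⟩, ⟨h2, h2'⟩, ⟨h3, h3'⟩, ⟨h4, h4'⟩⟩ := mem_solutionBox_of_mem_closedBall hx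
  dsimp only at h1 h1' h2 h2' h3 h3' h4 h4'
  refine ⟨x 0, x 1, x 2, x 3, ?_, ?_, ?_, ?_, ?_, ?_, ?_, ?_, eq_zero_of_preconditioned_eq_zero h⟩
  all_goals linarith
end
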